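/- arXiv:2202.03011 — 2 statements merged into one kernel-verified Lean document; each statement's English description precedes it below -/
import Mathlib

section
/- Let τ be a pyramidal tour with step-backs on {1,...,n}. Then τ is uniquely determined by its pyramidal encoding, i.e., the map sending τ to the vector in {1, 0, step-back-up, step-back-down}-labelled coordinates 2,...,n−1 (recording for each city whether it is visited in ascending order, descending order, or is a step-back peak in ascending/descending direction) is injective on the set of pyramidal tours with step-backs. -/
/-- A Hamiltonian tour on the cities `{1,…,n}` (represented as `Fin n`,
city `c` corresponding to the element `c-1`): a permutation acting cyclically on all cities. -/
def IsTour {n : ℕ} (τ : Equiv.Perm (Fin n)) : Prop :=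
  ∀ i j : Fin n, ∃ k : ℕ, (τ ^ k) i = j

/-- `i` is a peak of the tour `τ`. -/
def IsPeak {n : ℕ} (τ : Equiv.Perm (Fin n)) (i : Fin n) : Prop :=
  τ⁻¹ i < i ∧ τ i < i

/-- `i` is a step-back peak of `τ`: either `τ⁻¹ i < i`, `τ i = i - 1`, `τ² i > i`
(ascending step-back) or `τ⁻² i > i`, `τ⁻¹ i = i - 1`, `τ i < i` (descending step-back). -/
def IsStepBackPeak {n : ℕ} (τ : Equiv.Perm (Fin n)) (i : Fin n) : Prop :=
  (τ⁻¹ i < i ∧ ((τ i : ℕ) + 1 = (i : ℕ)) ∧ i < τ (τ i)) ∨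
  (i < τ⁻¹ (τ⁻¹ i) ∧ ((τ⁻¹ i : ℕ) + 1 = (i : ℕ)) ∧ τ i < i)

/-- A pyramidal tour: a Hamiltonian tour whose unique peak is the last city `n`. -/
def IsPyramidal {n : ℕ} (τ : Equiv.Perm (Fin n)) : Prop :=
  IsTour τ ∧ ∀ i : Fin n, IsPeak τ i ↔ (i : ℕ) = n - 1

/-- A pyramidal tour with step-backs: a Hamiltonian tour with exactly one proper peak
(a peak that is not a step-back peak), namely the last city `n`. -/
def IsPSB {n : ℕ} (τ : Equiv.Perm (Fin n)) : Prop :=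
  IsTour τ ∧ ∀ i : Fin n, (IsPeak τ i ∧ ¬ IsStepBackPeak τ i) ↔ (i : ℕ) = n - 1

/-- City `i` is visited by `τ` in ascending order (taking step-backs into account):
either the successor of `i` is larger and `i` is not the lower city of a descending
step-back, or `i` is an ascending step-back peak. -/
def Ascends {n : ℕ} (τ : Equiv.Perm (Fin n)) (i : Fin n) : Prop :=
  (i < τ i ∧ ¬ (((i : ℕ) + 1 = (τ i : ℕ)) ∧ τ (τ i) < τ i ∧ τ i < τ⁻¹ i)) ∨
  (τ⁻¹ i < i ∧ ((τ i : ℕ) + 1 = (i : ℕ)) ∧ i < τ (τ i))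

/-- The city represented by the element of `Fin n` with value `m` is visited ascending. -/
def AscAt {n : ℕ} (τ : Equiv.Perm (Fin n)) (m : ℕ) : Prop :=
  ∃ i : Fin n, (i : ℕ) = m ∧ Ascends τ i

/-- The city represented by the element of `Fin n` with value `m` is a step-back peak. -/
def SBPeakAt {n : ℕ} (τ : Equiv.Perm (Fin n)) (m : ℕ) : Prop :=
  ∃ i : Fin n, (i : ℕ) = m ∧ IsStepBackPeak τ i

/-- The pyramidal encodings of `x` and `y` have the same value at coordinate `m`. -/
def SameEnc {n : ℕ} (x y : Equiv.Perm (Fin n)) (m : ℕ) : Prop :=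
  (AscAt x m ↔ AscAt y m) ∧ (SBPeakAt x m ↔ SBPeakAt y m)

/-- The pyramidal encodings of `x` and `y` agree on the pair of neighboring
coordinates `(k, k+1)`, including the step-back marks overlapping the pair. -/
def SamePair {n : ℕ} (x y : Equiv.Perm (Fin n)) (k : ℕ) : Prop :=
  SameEnc x y k ∧ SameEnc x y (k + 1) ∧ (SBPeakAt x (k + 2) ↔ SBPeakAt y (k + 2))

/-- Characteristic vector of a tour, in `ℝ^E` with `E = Fin n × Fin n`. -/
def chv {n : ℕ} (τ : Equiv.Perm (Fin n)) : Fin n × Fin n → ℝ :=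
  fun e => if τ e.1 = e.2 then 1 else 0

/-- The vertices of the polytope `PSB(n)`: characteristic vectors of all
pyramidal tours with step-backs. -/
def PSBvertices (n : ℕ) : Set (Fin n × Fin n → ℝ) :=
  chv '' {τ : Equiv.Perm (Fin n) | IsPSB τ}

/-- `u` and `w` are adjacent vertices in the 1-skeleton of the polytope `conv S`:
the segment `[u,w]` is a one-dimensional face (an extreme subset) of the polytope. -/
def AdjacentIn {n : ℕ} (S : Set (Fin n × Fin n → ℝ)) (u w : Fin n × Fin n → ℝ) : Prop :=
  u ≠ w ∧ IsExtreme ℝ (convexHull ℝ S) (segment ℝ u w)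

/-- The only valley of a fixed-point-free permutation with unique peak `l` is `z`. -/
lemma up_iff_of_nopeak {n : ℕ} (x : Equiv.Perm (Fin n)) (z l : Fin n) (hz : ∀ i, z ≤ i)
    (hl : ∀ i, i ≤ l) (hzl : z ≠ l)
    (hf : ∀ i, x i ≠ i) (hp : ∀ i, i ≠ l → x⁻¹ i < i → i < x i) (v : Fin n) (hv : v < x v)
    (hvz : v ≠ z) : x⁻¹ v < v := by
  classical
  have hfi : ∀ i, x⁻¹ i ≠ i := by
    intro i hi
    apply hf i
    conv_lhs => rw [← hi]
    simp
  set P : Finset (Fin n) := Finset.univ.filter (fun i => x⁻¹ i < i) with hP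
  set U : Finset (Fin n) := Finset.univ.filter (fun i => i < x i) with hU
  have hcard : P.card = U.card := by
    symm
    apply Finset.card_bij (fun i _ => x i)
    · intro a ha
      simp [hP, hU] at ha ⊢
      exact ha
    · intro a _ b _ hab
      exact x.injective hab
    · intro b hb
      refine ⟨x⁻¹ b, ?_, by simp⟩
      simp [hP, hU] at hb ⊢
      exact hb
  have hlP : l ∈ P := by
    simp only [hP, Finset.mem_filter, Finset.mem_univ, true_and]
    exact lt_of_le_of_ne (hl _) (hfi l)
  have hzU : z ∈ U := by
    simp only [hU, Finset.mem_filter, Finset.mem_univ, true_and]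
    exact lt_of_le_of_ne (hz _) (hf z).symm
  have hsub : P.erase l ⊆ U.erase z := by
    intro i hi
    simp only [hP, hU, Finset.mem_erase, Finset.mem_filter, Finset.mem_univ, true_and] at hi ⊢
    refine ⟨?_, hp i hi.1 hi.2⟩
    rintro rfl
    exact absurd hi.2 (not_lt.mpr (hz _))
  have heq := Finset.eq_of_subset_of_card_le hsub (by
    rw [Finset.card_erase_of_mem hlP, Finset.card_erase_of_mem hzU, hcard])
  have : v ∈ U.erase z := by
    simp only [hU, Finset.mem_erase, Finset.mem_filter, Finset.mem_univ, true_and]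
    exact ⟨hvz, hv⟩
  rw [← heq] at this
  simp only [hP, Finset.mem_erase, Finset.mem_filter, Finset.mem_univ, true_and] at this
  exact this.2

/-- A permutation without extra valleys moves an ascending city to the next ascending city. -/
lemma succ_claim {n : ℕ} (x : Equiv.Perm (Fin n)) (z : Fin n) (hz : ∀ i, z ≤ i)
    (hv : ∀ v, v < x v → v ≠ z → x⁻¹ v < v) (v : Fin n) :
    ∀ u, u < v → u < x u → v < x v → x u ≤ v := by
  induction v using WellFoundedLT.induction with
  | ind v ih =>
    intro u huv hu hvx
    have hvz : v ≠ z := fun h => absurd (hz u) (not_le.mpr (h ▸ huv))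
    have hw := hv v hvx hvz
    have hxw : x (x⁻¹ v) = v := by simp
    generalize x⁻¹ v = w at hw hxw
    rcases lt_trichotomy u w with h | h | h
    · exact (ih w hw u h hu (by rw [hxw]; exact hw)).trans hw.le
    · rw [h, hxw]
    · have := ih u huv w h (by rw [hxw]; exact hw) hu
      rw [hxw] at this
      exact absurd this (not_le.mpr huv)

lemma agree_up {n : ℕ} (x y : Equiv.Perm (Fin n)) (z l : Fin n) (hz : ∀ i, z ≤ i)
    (hl : ∀ i, i ≤ l) (hzl : z ≠ l)
    (hfx : ∀ i, x i ≠ i) (hpx : ∀ i, i ≠ l → x⁻¹ i < i → i < x i)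
    (hfy : ∀ i, y i ≠ i) (hpy : ∀ i, i ≠ l → y⁻¹ i < i → i < y i)
    (hup : ∀ i, i < x i → i < y i) (i : Fin n) (hi : i < x i) : y i ≤ x i := by
  by_contra hlt
  push Not at hlt
  have hne : x i ≠ l := fun h => absurd (hl (y i)) (not_le.mpr (h ▸ hlt))
  have h1 : x i < x (x i) := hpx _ hne (by simpa using hi)
  exact absurd (succ_claim y z hz (up_iff_of_nopeak y z l hz hl hzl hfy hpy) (x i) i hi
    (hup i hi) (hup _ h1)) (not_le.mpr hlt)

lemma pyramidal_unique {n : ℕ} (x y : Equiv.Perm (Fin n)) (z l : Fin n) (hz : ∀ i, z ≤ i)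
    (hl : ∀ i, i ≤ l) (hzl : z ≠ l)
    (hfx : ∀ i, x i ≠ i) (hpx : ∀ i, i ≠ l → x⁻¹ i < i → i < x i)
    (hfy : ∀ i, y i ≠ i) (hpy : ∀ i, i ≠ l → y⁻¹ i < i → i < y i)
    (hup : ∀ i, i < x i ↔ i < y i) : x = y := by
  have inv : ∀ (x : Equiv.Perm (Fin n)), (∀ i, x i ≠ i) → ∀ i, x⁻¹ i ≠ i := by
    intro x hf i hi
    apply hf i
    conv_lhs => rw [← hi]
    simp
  have hpi : ∀ (x : Equiv.Perm (Fin n)), (∀ i, x i ≠ i) →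
      (∀ i, i ≠ l → x⁻¹ i < i → i < x i) → ∀ i, i ≠ l → (x⁻¹)⁻¹ i < i → i < x⁻¹ i := by
    intro x hf hp i hil hi
    rw [inv_inv] at hi
    by_contra hn
    exact absurd (hp i hil (lt_of_le_of_ne (not_lt.mp hn) (inv x hf i))) (not_lt.mpr hi.le)
  have hdn : ∀ (x y : Equiv.Perm (Fin n)), (∀ i, x i ≠ i) →
      (∀ i, i ≠ l → x⁻¹ i < i → i < x i) → (∀ i, y i ≠ i) →
      (∀ i, i ≠ l → y⁻¹ i < i → i < y i) → 
      (∀ i, i < x i ↔ i < y i) → ∀ i, i < x⁻¹ i → i < y⁻¹ i := by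
    intro x y hfx hpx hfy hpy hup i hi
    by_contra hn
    have h1 := lt_of_le_of_ne (not_lt.mp hn) (inv y hfy i)
    by_cases hil : i = l
    · exact absurd (hl (x⁻¹ i)) (not_le.mpr (hil ▸ hi))
    have h2 := (hup i).2 (hpy i hil h1)
    by_cases hiz : i = z
    · exact absurd (hz (y⁻¹ i)) (not_le.mpr (hiz ▸ h1))
    exact absurd (up_iff_of_nopeak x z l hz hl hzl hfx hpx i h2 hiz) (not_lt.mpr hi.le)
  ext i
  congr 1
  by_cases hi : i < x i
  · apply le_antisymm
    · exact agree_up y x z l hz hl hzl hfy hpy hfx hpx (fun i => (hup i).2) i ((hup i).1 hi)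
    · exact agree_up x y z l hz hl hzl hfx hpx hfy hpy (fun i => (hup i).1) i hi
  · have hj : x i < x⁻¹ (x i) := by
      simpa using lt_of_le_of_ne (not_lt.mp hi) (hfx i)
    have hj' := hdn x y hfx hpx hfy hpy hup _ hj
    have e : x⁻¹ (x i) = y⁻¹ (x i) := by
      apply le_antisymm
      · exact agree_up y⁻¹ x⁻¹ z l hz hl hzl (inv y hfy) (hpi y hfy hpy) (inv x hfx)
          (hpi x hfx hpx) (hdn y x hfy hpy hfx hpx (fun i => (hup i).symm)) _ hj'
      · exact agree_up x⁻¹ y⁻¹ z l hz hl hzl (inv x hfx) (hpi x hfx hpx) (inv y hfy)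
          (hpi y hfy hpy) (hdn x y hfx hpx hfy hpy hup) _ hj
    have e2 := congrArg y e
    simp at e2
    exact e2.symm

/-- A tour on at least three cities has no fixed point and no 2-cycle. -/
lemma tour_no_short {n : ℕ} (hn : 3 ≤ n) (x : Equiv.Perm (Fin n)) (hx : IsTour x) (i : Fin n) :
    x i ≠ i ∧ x (x i) ≠ i := by
  have key : x (x i) ≠ i := by
    intro h
    have hk : ∀ k : ℕ, (x ^ k) i = i ∨ (x ^ k) i = x i := by
      intro k
      induction k with
      | zero => left; simp
      | succ k ih =>
        rw [pow_succ', Equiv.Perm.mul_apply]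
        rcases ih with h' | h' <;> rw [h']
        · right; rfl
        · left; exact h
    have : (Finset.univ : Finset (Fin n)) ⊆ {i, x i} := by
      intro j _
      obtain ⟨k, hk'⟩ := hx i j
      rcases hk k with h' | h' <;> simp [← hk', h']
    have h1 := Finset.card_le_card this
    have h2 := Finset.card_le_two (a := i) (b := x i)
    simp at h1
    omega
  exact ⟨fun h => key (by rw [h, h]), key⟩

/-- The facts about the swap of step-back pairs. -/
structure IsSwap {n : ℕ} (x : Equiv.Perm (Fin n)) (σ : Fin n → Fin n) : Prop where
  /-- involution -/
  inv : ∀ i, σ (σ i) = i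
  /-- up-moved cities are lower cities of a step-back pair -/
  cases : ∀ i, σ i = i ∧ ¬ IsStepBackPeak x i ∧ (∀ j : Fin n, (j : ℕ) = i + 1 → ¬ IsStepBackPeak x j)
    ∨ ((σ i : ℕ) + 1 = i ∧ IsStepBackPeak x i) ∨ ((σ i : ℕ) = i + 1 ∧ IsStepBackPeak x (σ i))

open Classical in
/-- The swap of step-back pairs. -/
noncomputable def swapFun {n : ℕ} (s : Fin n → Prop) (i : Fin n) : Fin n :=
  if s i then ⟨(i : ℕ) - 1, by omega⟩
  else if h : ∃ j : Fin n, (j : ℕ) = i + 1 ∧ s j then h.choose else i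

lemma sb_facts {n : ℕ} (hn : 3 ≤ n) (x : Equiv.Perm (Fin n)) (hx : IsTour x) (p q : Fin n)
    (hpq : (p : ℕ) + 1 = q) (h : IsStepBackPeak x q) :
    (x q = p ∧ x⁻¹ q < p ∧ q < x p ∧ x⁻¹ p = q) ∨ (x⁻¹ q = p ∧ x q < p ∧ q < x⁻¹ p ∧ x p = q) := by
  have h2 := (tour_no_short hn x hx (x⁻¹ q)).2
  rw [show x (x⁻¹ q) = q from x.apply_symm_apply q] at h2
  rcases h with ⟨a, b, c⟩ | ⟨a, b, c⟩
  · left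
    have e : x q = p := by apply Fin.ext; omega
    have e' : x⁻¹ p = q := by rw [← e]; simp
    rw [e] at c h2
    refine ⟨e, ?_, c, e'⟩
    rw [Fin.lt_def] at *
    have : (x⁻¹ q : ℕ) ≠ p := fun h => h2 (Fin.ext h.symm)
    omega
  · right
    have e : x⁻¹ q = p := by apply Fin.ext; omega
    have e' : x p = q := by rw [← e]; simp
    rw [e] at a h2
    refine ⟨e, ?_, a, e'⟩
    rw [Fin.lt_def] at *
    have : (x q : ℕ) ≠ p := fun h => h2 (Fin.ext h)
    omega

lemma sb_pos {n : ℕ} (x : Equiv.Perm (Fin n)) (q : Fin n)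
    (h : IsStepBackPeak x q) : 1 ≤ (q : ℕ) ∧ (q : ℕ) + 2 ≤ n := by
  rcases h with ⟨a, b, c⟩ | ⟨a, b, c⟩ <;> rw [Fin.lt_def] at * <;> omega

lemma swap_ok {n : ℕ} (hn : 3 ≤ n) (x : Equiv.Perm (Fin n)) (hx : IsTour x) :
    IsSwap x (swapFun (IsStepBackPeak x)) := by
  have disj : ∀ i j : Fin n, (j : ℕ) = i + 1 → IsStepBackPeak x i → IsStepBackPeak x j → False := by
    intro i j hij hi hj
    have h0 := sb_pos x i hi
    have h1 := sb_facts hn x hx ⟨i - 1, by omega⟩ i (by simp; omega) hi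
    have h2 := sb_facts hn x hx i j hij.symm hj
    simp only [Fin.lt_def] at *
    rcases h1 with ⟨a, b, c, d⟩ | ⟨a, b, c, d⟩ <;> rcases h2 with ⟨a', b', c', d'⟩ | ⟨a', b', c', d'⟩ <;>
      simp_all <;> omega
  have hc : ∀ i, swapFun (IsStepBackPeak x) i = i ∧ ¬ IsStepBackPeak x i ∧
      (∀ j : Fin n, (j : ℕ) = i + 1 → ¬ IsStepBackPeak x j)
    ∨ ((swapFun (IsStepBackPeak x) i : ℕ) + 1 = i ∧ IsStepBackPeak x i) ∨
      ((swapFun (IsStepBackPeak x) i : ℕ) = i + 1 ∧ IsStepBackPeak x (swapFun (IsStepBackPeak x) i)) := by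
    intro i
    unfold swapFun
    by_cases h : IsStepBackPeak x i
    · have := sb_pos x i h
      right; left
      simp only [h, if_true]
      exact ⟨by omega, trivial⟩
    · by_cases h' : ∃ j : Fin n, (j : ℕ) = i + 1 ∧ IsStepBackPeak x j
      · right; right
        simp only [h, if_false, h', dite_true]
        exact h'.choose_spec
      · left
        simp only [h, if_false, h', dite_false]
        exact ⟨trivial, not_false, fun j hj hs => h' ⟨j, hj, hs⟩⟩
  refine ⟨?_, hc⟩
  intro i
  have h1 := hc i
  have h2 := hc (swapFun (IsStepBackPeak x) i)
  generalize swapFun (IsStepBackPeak x) i = k at *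
  generalize swapFun (IsStepBackPeak x) k = m at *
  rcases h1 with ⟨a, b, c⟩ | ⟨a, b⟩ | ⟨a, b⟩
  · subst a
    rcases h2 with ⟨a', b', c'⟩ | ⟨a', b'⟩ | ⟨a', b'⟩
    · exact a'
    · exact absurd b' b
    · exact absurd b' (c _ a')
  · rcases h2 with ⟨a', b', c'⟩ | ⟨a', b'⟩ | ⟨a', b'⟩
    · exact absurd b (c' i a.symm)
    · exact (disj _ _ a.symm b' b).elim
    · exact Fin.ext (by omega)
  · rcases h2 with ⟨a', b', c'⟩ | ⟨a', b'⟩ | ⟨a', b'⟩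
    · exact absurd b b'
    · exact Fin.ext (by omega)
    · exact (disj _ _ a' b b').elim

lemma swap_mono {n : ℕ} {x : Equiv.Perm (Fin n)} {σ : Fin n → Fin n} (h : IsSwap x σ)
    (u v : Fin n) (huv : u < v) (hne : v ≠ σ u) : σ u < σ v := by
  have hne' : u ≠ σ v := fun e => hne (by rw [e, h.inv])
  have h1 : σ u ≠ σ v := fun e => huv.ne (by rw [← h.inv u, e, h.inv])
  have a := h.cases u
  have b := h.cases v
  rw [Fin.lt_def] at *
  have i1 : (v : ℕ) ≠ σ u := fun e => hne (Fin.ext e)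
  have i2 : (u : ℕ) ≠ σ v := fun e => hne' (Fin.ext e)
  have i3 : (σ u : ℕ) ≠ σ v := fun e => h1 (Fin.ext e)
  rcases a with ⟨a, -⟩ | ⟨a, -⟩ | ⟨a, -⟩ <;> rcases b with ⟨b, -⟩ | ⟨b, -⟩ | ⟨b, -⟩ <;>
    (try rw [Fin.ext_iff] at a) <;> (try rw [Fin.ext_iff] at b) <;> omega

/-- Comparison of `i` with the image of its neighbour `w`. -/
lemma swap_lt {n : ℕ} {x : Equiv.Perm (Fin n)} {σ : Fin n → Fin n} (h : IsSwap x σ)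
    (i w : Fin n) (hw : w ≠ i) : i < σ w ↔ σ i < w := by
  constructor
  · intro hlt
    have := swap_mono h i (σ w) hlt (fun e => hw (by rw [← h.inv w, e, h.inv]))
    rwa [h.inv] at this
  · intro hlt
    have := swap_mono h (σ i) w hlt (by rw [h.inv]; exact hw)
    rwa [h.inv] at this

lemma swap_gt {n : ℕ} {x : Equiv.Perm (Fin n)} {σ : Fin n → Fin n} (h : IsSwap x σ)
    (i w : Fin n) (hw : w ≠ i) : σ w < i ↔ w < σ i := 
  (swap_lt h w i hw.symm).symm

/-- The tour with step-backs removed. -/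
lemma conj_facts {n : ℕ} (hn : 3 ≤ n) (x : Equiv.Perm (Fin n)) (hx : IsPSB x) (σ : Fin n → Fin n)
    (h : IsSwap x σ) (i : Fin n) (hi : (i : ℕ) ≠ n - 1) :
    (σ (x⁻¹ (σ i)) < i → i < σ (x (σ i))) ∧ (1 ≤ (i : ℕ) → (i < σ (x (σ i)) ↔ Ascends x i)) := by
  have hpk : ∀ j : Fin n, (j : ℕ) ≠ n - 1 → x⁻¹ j < j → x j < j → IsStepBackPeak x j := by
    intro j hj h1 h2
    by_contra h3
    exact hj ((hx.2 j).1 ⟨⟨h1, h2⟩, h3⟩)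
  have f1 : ∀ j, x j ≠ j := fun j => (tour_no_short hn x hx.1 j).1
  rcases h.cases i with ⟨a, b, c⟩ | ⟨a, b⟩ | ⟨a, b⟩
  · have f2 : x⁻¹ i ≠ i := fun e => f1 i (by conv_lhs => rw [← e]
                                             simp)
    rw [swap_lt h i _ (by rw [a]; exact f1 i), swap_gt h i _ (by rw [a]; exact f2), a]
    constructor
    · intro h1
      by_contra h2
      exact b (hpk i hi h1 (lt_of_le_of_ne (not_lt.mp h2) (f1 i)))
    · intro _
      constructor
      · intro h1
        left
        refine ⟨h1, ?_⟩
        rintro ⟨h3, h4, h5⟩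
        apply c (x i) h3.symm
        right
        rw [show x⁻¹ (x i) = i from x.symm_apply_apply i]
        exact ⟨h5, h3, h4⟩
      · rintro (⟨h1, -⟩ | h1)
        · exact h1
        · exact absurd (Or.inl h1) b
  · -- `i` is the upper city
    rcases sb_facts hn x hx.1 (σ i) i a b with ⟨h1, h2, h3, h4⟩ | ⟨h1, h2, h3, h4⟩
    · rw [swap_lt h i _ h3.ne']
      have h5 : σ i < x (σ i) := lt_trans (by rw [Fin.lt_def]; omega) h3
      refine ⟨fun _ => h5, fun _ => ⟨fun _ => Or.inr ⟨?_, ?_, ?_⟩, fun _ => h5⟩⟩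
      · exact lt_trans h2 (by rw [Fin.lt_def]; omega)
      · rw [h1]; exact a
      · rw [h1]; exact h3
    · have h6 : σ i < i := by rw [Fin.lt_def]; omega
      rw [h4, swap_gt h i _ h3.ne']
      refine ⟨fun h7 => absurd h7 (not_lt.mpr (h6.trans h3).le),
        fun _ => ⟨fun h7 => absurd h7 (not_lt.mpr h6.le), ?_⟩⟩
      rintro (⟨h7, -⟩ | ⟨-, h7, -⟩)
      · exact absurd h7 (not_lt.mpr (h2.trans h6).le)
      · rw [Fin.lt_def] at h2
        omega
  · -- `i` is the lower city
    have h6 : i < σ i := by rw [Fin.lt_def]; omega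
    rcases sb_facts hn x hx.1 i (σ i) a.symm b with ⟨h1, h2, h3, h4⟩ | ⟨h1, h2, h3, h4⟩
    · rw [h1]
      refine ⟨fun _ => h6, fun _ => ⟨fun _ => Or.inl ⟨h6.trans h3, ?_⟩, fun _ => h6⟩⟩
      rintro ⟨h7, -⟩
      rw [Fin.lt_def] at h3
      omega
    · rw [h1, swap_lt h i _ h2.ne]
      have h7 : ¬ σ i < x (σ i) := not_lt.mpr (h2.trans h6).le
      refine ⟨fun h8 => absurd h8 (not_lt.mpr h6.le), fun _ => ⟨fun h8 => absurd h8 h7, ?_⟩⟩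
      rintro (⟨-, h8⟩ | ⟨h8, -, -⟩)
      · refine (h8 ⟨?_, ?_, ?_⟩).elim
        · rw [h4]; exact a.symm
        · rw [h4]; exact h2.trans h6
        · rw [h4]; exact h3
      · exact absurd h8 (not_lt.mpr (h6.trans h3).le)

/-- A pyramidal tour with step-backs is uniquely determined by its pyramidal encoding. -/
theorem stmt1 (n : ℕ) (x y : Equiv.Perm (Fin n)) (hx : IsPSB x) (hy : IsPSB y)
    (h : ∀ m : ℕ, 1 ≤ m → m ≤ n - 2 → SameEnc x y m) : x = y := by
  by_cases hn : 3 ≤ n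
  · have atx : ∀ (P : Fin n → Prop) (i : Fin n), (∃ j : Fin n, (j : ℕ) = i ∧ P j) ↔ P i := by
      intro P i
      constructor
      · rintro ⟨j, h1, h2⟩
        rwa [← Fin.ext h1]
      · exact fun h => ⟨i, rfl, h⟩
    have hs : IsStepBackPeak x = IsStepBackPeak y := by
      funext i
      apply propext
      by_cases hi : 1 ≤ (i : ℕ) ∧ (i : ℕ) + 2 ≤ n
      · have := (h i hi.1 (by omega)).2
        unfold SBPeakAt at this
        rwa [atx, atx] at this
      · exact ⟨fun h => (hi (sb_pos _ _ h)).elim, fun h => (hi (sb_pos _ _ h)).elim⟩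
    have sx := swap_ok hn x hx.1
    have sy := swap_ok hn y hy.1
    rw [← hs] at sy
    generalize swapFun (IsStepBackPeak x) = σ at sx sy
    let s : Equiv.Perm (Fin n) := ⟨σ, σ, sx.inv, sx.inv⟩
    have ss : ∀ i, s i = σ i := fun _ => rfl
    have si : s⁻¹ = s := rfl
    have ap : ∀ (t : Equiv.Perm (Fin n)) i, (s * t * s) i = σ (t (σ i)) := fun _ _ => rfl
    have api : ∀ (t : Equiv.Perm (Fin n)) i, (s * t * s)⁻¹ i = σ (t⁻¹ (σ i)) := fun _ _ => rfl
    have fx : ∀ (t : Equiv.Perm (Fin n)), IsPSB t → ∀ i, (s * t * s) i ≠ i := by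
      intro t ht i e
      rw [ap] at e
      apply (tour_no_short hn t ht.1 (σ i)).1
      rw [← sx.inv (t (σ i)), e]
    let z : Fin n := ⟨0, by omega⟩
    let l : Fin n := ⟨n - 1, by omega⟩
    have hz : ∀ i, z ≤ i := fun i => Nat.zero_le _
    have hl : ∀ i, i ≤ l := fun i => by
      rw [Fin.le_def]; simp only [l]; omega
    have key : s * x * s = s * y * s := by
      apply pyramidal_unique _ _ z l hz hl
      · intro e
        have := congrArg Fin.val e
        simp only [z, l] at this
        omega
      · exact fx x hx
      · intro i hi
        rw [ap, api]
        exact (conj_facts hn x hx σ sx i (fun e => hi (Fin.ext e))).1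
      · exact fx y hy
      · intro i hi
        rw [ap, api]
        exact (conj_facts hn y hy σ sy i (fun e => hi (Fin.ext e))).1
      · intro i
        by_cases hil : i = l
        · exact ⟨fun h => absurd (hl _) (not_le.mpr (hil ▸ h)),
            fun h => absurd (hl _) (not_le.mpr (hil ▸ h))⟩
        by_cases hiz : i = z
        · rw [hiz]
          exact ⟨fun _ => lt_of_le_of_ne (hz _) (fx y hy z).symm,
            fun _ => lt_of_le_of_ne (hz _) (fx x hx z).symm⟩
        have i1 : (i : ℕ) ≠ n - 1 := fun e => hil (Fin.ext e)
        have i0 : (i : ℕ) ≠ 0 := fun e => hiz (Fin.ext e)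
        have i2 : 1 ≤ (i : ℕ) := by omega
        rw [ap, ap, (conj_facts hn x hx σ sx i i1).2 i2, (conj_facts hn y hy σ sy i i1).2 i2]
        have := (h i i2 (by omega)).1
        unfold AscAt at this
        rwa [atx, atx] at this
    exact mul_left_cancel (mul_right_cancel key)
  · have h2 : ∀ t : Equiv.Perm (Fin n), IsPSB t → ∀ i : Fin n, (i : ℕ) = n - 1 →
        t i < i ∧ t⁻¹ i < i := by
      intro t ht i hi
      have := ((ht.2 i).2 hi).1
      exact ⟨this.2, this.1⟩
    ext i
    have hlt := i.isLt
    have ax := h2 x hx ⟨n - 1, by omega⟩ rfl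
    have ay := h2 y hy ⟨n - 1, by omega⟩ rfl
    simp only [Fin.lt_def] at ax ay
    have hn2 : n = 2 := by omega
    subst hn2
    have hxi := (x i).isLt
    have hyi := (y i).isLt
    by_cases hi : (i : ℕ) = 1
    · have e : i = ⟨2 - 1, by omega⟩ := Fin.ext hi
      rw [e]
      omega
    · have key : ∀ t : Equiv.Perm (Fin 2), ((t ⟨2 - 1, by omega⟩ : Fin 2) : ℕ) < 2 - 1 →
          ((t i : Fin 2) : ℕ) = 1 := by
        intro t ht
        have : (t i : ℕ) ≠ t ⟨2 - 1, by omega⟩ := by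
          intro e
          have := t.injective (Fin.ext e)
          exact hi (by rw [this])
        have := (t i).isLt
        omega
      rw [key x ax.1, key y ay.1]
end

section
/- The clique number of the 1-skeleton of PSB(n) is O(n²); combined with the lower bound ⌊n/2⌋², the clique number of the 1-skeleton of PSB(n) is Θ(n²). -/
/-- The clique number of the 1-skeleton of `PSB(n)`: the largest cardinality of a
set of pairwise adjacent vertices. -/
noncomputable def PSBCliqueNumber (n : ℕ) : ℕ :=
  sSup {m | ∃ V : Finset (Fin n × Fin n → ℝ), ↑V ⊆ PSBvertices n ∧
    (∀ u ∈ V, ∀ w ∈ V, u ≠ w → AdjacentIn (PSBvertices n) u w) ∧ V.card = m}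

lemma sbp_inv {n : ℕ} (τ : Equiv.Perm (Fin n)) (i : Fin n) :
    IsStepBackPeak τ⁻¹ i ↔ IsStepBackPeak τ i := by
  unfold IsStepBackPeak
  simp only [inv_inv]
  tauto

lemma peak_inv {n : ℕ} (τ : Equiv.Perm (Fin n)) (i : Fin n) :
    IsPeak τ⁻¹ i ↔ IsPeak τ i := by
  unfold IsPeak
  simp only [inv_inv]
  tauto

lemma tour_iff_sameCycle {n : ℕ} (τ : Equiv.Perm (Fin n)) :
    IsTour τ ↔ ∀ i j, τ.SameCycle i j := by
  constructor
  · intro h i j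
    obtain ⟨k, hk⟩ := h i j
    exact ⟨k, by simpa using hk⟩
  · intro h i j
    obtain ⟨k, -, hk⟩ := (h i j).exists_pow_eq' 
    exact ⟨k, hk⟩

lemma tour_inv {n : ℕ} {τ : Equiv.Perm (Fin n)} (h : IsTour τ) : IsTour τ⁻¹ := by
  rw [tour_iff_sameCycle] at *
  intro i j
  exact Equiv.Perm.sameCycle_inv.2 (h i j)

lemma tour_closed {n : ℕ} {τ : Equiv.Perm (Fin n)} (h : IsTour τ) (S : Fin n → Prop)
    (i : Fin n) (hi : S i) (hS : ∀ i, S i → S (τ i)) (j : Fin n) : S j := by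
  obtain ⟨k, rfl⟩ := h i j
  induction k with
  | zero => simpa
  | succ k ih =>
    rw [pow_succ', Equiv.Perm.mul_apply]
    exact hS _ ih

lemma tour_of_closed {n : ℕ} {τ : Equiv.Perm (Fin n)}
    (h : ∀ S : Fin n → Prop, ∀ i, S i → (∀ i, S i → S (τ i)) → ∀ j, S j) : IsTour τ := by
  intro i
  apply h (fun j => ∃ k : ℕ, (τ ^ k) i = j) i ⟨0, by simp⟩
  rintro _ ⟨k, rfl⟩
  exact ⟨k + 1, by rw [pow_succ', Equiv.Perm.mul_apply]⟩

lemma tour_nofix {n : ℕ} (hn : 3 ≤ n) {τ : Equiv.Perm (Fin n)} (h : IsTour τ) (i : Fin n) :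
    τ i ≠ i := by
  intro hi
  have := tour_closed h (fun j => j = i) i rfl (by rintro _ rfl; exact hi)
  have h0 := this ⟨0, by omega⟩
  have h1 := this ⟨1, by omega⟩
  rw [← h1] at h0
  simp at h0

lemma tour_no2 {n : ℕ} (hn : 3 ≤ n) {τ : Equiv.Perm (Fin n)} (h : IsTour τ) (i : Fin n) :
    τ (τ i) ≠ i := by
  intro hi
  have := tour_closed h (fun j => j = i ∨ j = τ i) i (Or.inl rfl)
    (by rintro _ (rfl | rfl) <;> simp [hi])
  have h0 := this ⟨0, by omega⟩
  have h1 := this ⟨1, by omega⟩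
  have h2 := this ⟨2, by omega⟩
  simp only [Fin.ext_iff] at h0 h1 h2
  omega

lemma psb_iff {n : ℕ} (hn : 3 ≤ n) (τ : Equiv.Perm (Fin n)) :
    IsPSB τ ↔ IsTour τ ∧ ∀ i : Fin n, IsPeak τ i → (i : ℕ) ≠ n - 1 → IsStepBackPeak τ i := by
  constructor
  · rintro ⟨h1, h2⟩
    refine ⟨h1, fun i hp hi => ?_⟩
    by_contra hs
    exact hi ((h2 i).1 ⟨hp, hs⟩)
  · rintro ⟨h1, h2⟩
    refine ⟨h1, fun i => ⟨fun ⟨hp, hs⟩ => ?_, fun hi => ⟨⟨?_, ?_⟩, ?_⟩⟩⟩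
    · by_contra hi
      exact hs (h2 i hp hi)
    · have := tour_nofix hn (tour_inv h1) i
      have h3 := (τ⁻¹ i).2
      rw [Ne, Fin.ext_iff] at this
      rw [Fin.lt_def]; omega
    · have := tour_nofix hn h1 i
      have h3 := (τ i).2
      rw [Ne, Fin.ext_iff] at this
      rw [Fin.lt_def]; omega
    · have h3 := (τ (τ i)).2
      have h4 := (τ⁻¹ (τ⁻¹ i)).2
      rintro (⟨-, -, h⟩ | ⟨h, -, -⟩) <;> rw [Fin.lt_def] at h <;> omega

lemma psb_inv {n : ℕ} (hn : 3 ≤ n) {τ : Equiv.Perm (Fin n)} (h : IsPSB τ) : IsPSB τ⁻¹ := by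
  rw [psb_iff hn] at *
  refine ⟨tour_inv h.1, fun i hp hi => ?_⟩
  rw [sbp_inv]
  rw [peak_inv] at hp
  exact h.2 i hp hi

lemma sbp_last {n : ℕ} (τ : Equiv.Perm (Fin n)) (i : Fin n) (hi : (i : ℕ) = n - 1) :
    ¬ IsStepBackPeak τ i := by
  have h3 := (τ (τ i)).2
  have h4 := (τ⁻¹ (τ⁻¹ i)).2
  rintro (⟨-, -, h⟩ | ⟨h, -, -⟩) <;> rw [Fin.lt_def] at h <;> omega

lemma sbp_peak {n : ℕ} (τ : Equiv.Perm (Fin n)) (i : Fin n) (h : IsStepBackPeak τ i) :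
    IsPeak τ i := by
  rcases h with ⟨h1, h2, h3⟩ | ⟨h1, h2, h3⟩
  · exact ⟨h1, by rw [Fin.lt_def]; omega⟩
  · exact ⟨by rw [Fin.lt_def]; omega, h3⟩

/-- two consecutive cities cannot both be step-back peaks -/
lemma sbp_succ {n : ℕ} (τ : Equiv.Perm (Fin n)) (i j : Fin n) (hij : (i : ℕ) + 1 = j)
    (h : IsStepBackPeak τ j) : ¬ IsStepBackPeak τ i := by
  intro hi
  have hp := sbp_peak τ i hi
  rcases h with ⟨h1, h2, h3⟩ | ⟨h1, h2, h3⟩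
  · have : τ j = i := by ext; omega
    rw [this] at h3
    have := hp.2
    rw [Fin.lt_def] at *
    omega
  · have : τ⁻¹ j = i := by ext; omega
    rw [this] at h1
    have := hp.1
    rw [Fin.lt_def] at *
    omega

/-- at a level which is not a step-back peak, at most one arc goes up. -/
lemma up_unique {n : ℕ} (hn : 3 ≤ n) {τ : Equiv.Perm (Fin n)} (h : IsPSB τ) :
    ∀ d : ℕ, ∀ k : Fin n, (k : ℕ) + d = n - 1 → ¬ IsStepBackPeak τ k →
    ∀ a a' : Fin n, a < k → k ≤ τ a → a' < k → k ≤ τ a' → a = a' := by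
  have hp := ((psb_iff hn τ).1 h).2
  have inj : ∀ i j, τ i = τ j → i = j := fun i j h => τ.injective h
  intro d
  induction d using Nat.strong_induction_on with
  | _ d ih =>
  intro k hk hs a a' ha hka ha' hka'
  by_cases hd : d = 0
  · apply inj
    have := (τ a).2
    have := (τ a').2
    rw [Fin.le_def] at *
    ext; omega
  obtain ⟨k1, hk1⟩ : ∃ k1 : Fin n, (k1 : ℕ) = k + 1 := ⟨⟨k + 1, by omega⟩, rfl⟩
  by_cases hs1 : IsStepBackPeak τ k1
  · have hne : (k1 : ℕ) ≠ n - 1 := fun hh => sbp_last τ k1 hh hs1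
    have := k1.2
    obtain ⟨k2, hk2⟩ : ∃ k2 : Fin n, (k2 : ℕ) = k + 2 := ⟨⟨k + 2, by omega⟩, rfl⟩
    have hs2 : ¬ IsStepBackPeak τ k2 := fun hh => sbp_succ τ k1 k2 (by omega) hh hs1
    have IH := ih (d - 2) (by omega) k2 (by omega) hs2
    rcases hs1 with ⟨h1, h2, h3⟩ | ⟨h1, h2, h3⟩
    · have e1 : τ k1 = k := by ext; omega
      rw [e1] at h3
      have key : ∀ b, b < k → k ≤ τ b → τ b = k1 := by
        intro b hb hkb
        by_contra hne
        have : τ b ≠ k := by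
          intro hh
          have := inj b k1 (by rw [hh, e1])
          rw [Fin.lt_def] at hb
          omega
        have := IH b k (by rw [Fin.lt_def] at *; omega)
          (by rw [Fin.le_def] at *; rw [Ne, Fin.ext_iff] at *; omega)
          (by rw [Fin.lt_def] at *; omega)
          (by rw [Fin.le_def] at *; rw [Fin.lt_def] at *; omega)
        exact absurd hb (by rw [this]; exact lt_irrefl _)
      exact inj _ _ (by rw [key a ha hka, key a' ha' hka'])
    · have e1 : τ⁻¹ k1 = k := by ext; omega
      rw [e1] at h1
      have e2 : τ k = k1 := by rw [← e1]; simp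
      have key : ∀ b, b < k → k ≤ τ b → k2 ≤ τ b := by
        intro b hb hkb
        have : τ b ≠ k := by
          intro hh
          have : b = τ⁻¹ k := by rw [← hh]; simp
          rw [← this] at h1
          rw [Fin.lt_def] at *
          omega
        have : τ b ≠ k1 := by
          intro hh
          have := inj b k (by rw [hh, e2])
          exact absurd hb (by rw [this]; exact lt_irrefl _)
        rw [Fin.le_def] at *; rw [Ne, Fin.ext_iff] at *; omega
      exact IH a a' (by rw [Fin.lt_def] at *; omega) (key a ha hka)
        (by rw [Fin.lt_def] at *; omega) (key a' ha' hka')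
  · have IH := ih (d - 1) (by omega) k1 (by omega) hs1
    have key : ∀ b b', b < k → k ≤ τ b → b' < k → k ≤ τ b' → τ b = k → τ b' ≠ k → False := by
      intro b b' hb hkb hb' hkb' e1 e2
      have hb1 : τ⁻¹ k = b := by rw [← e1]; simp
      by_cases hkk : τ k < k
      · exact hs (hp k ⟨by rw [hb1]; exact hb, hkk⟩ (by omega))
      · have := tour_nofix hn h.1 k
        have := IH k b' (by rw [Fin.lt_def] at *; omega)
          (by rw [Fin.le_def] at *; rw [Fin.lt_def] at *; rw [Ne, Fin.ext_iff] at *; omega)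
          (by rw [Fin.lt_def] at *; omega)
          (by rw [Fin.le_def] at *; rw [Ne, Fin.ext_iff] at *; omega)
        exact absurd hb' (by rw [this]; exact lt_irrefl _)
    by_cases e1 : τ a = k
    · by_cases e2 : τ a' = k
      · exact inj _ _ (by rw [e1, e2])
      · exact (key a a' ha hka ha' hka' e1 e2).elim
    · by_cases e2 : τ a' = k
      · exact (key a' a ha' hka' ha hka e2 e1).elim
      · exact IH a a' (by rw [Fin.lt_def] at *; omega)
          (by rw [Fin.le_def] at *; rw [Fin.ext_iff] at *; omega)
          (by rw [Fin.lt_def] at *; omega)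
          (by rw [Fin.le_def] at *; rw [Fin.ext_iff] at *; omega)

/-- `(a, c)` is the state of the tour at level `k`. -/
def StAt {n : ℕ} (τ : Equiv.Perm (Fin n)) (k a c : Fin n) : Prop :=
  ¬ IsStepBackPeak τ k ∧ a < k ∧ k ≤ τ a ∧ c < k ∧ k ≤ τ⁻¹ c

lemma StAt.inv {n : ℕ} {τ : Equiv.Perm (Fin n)} {k a c : Fin n} (h : StAt τ k a c) :
    StAt τ⁻¹ k c a := by
  obtain ⟨h1, h2, h3, h4, h5⟩ := h
  exact ⟨by rwa [sbp_inv], h4, h5, h2, by simpa using h3⟩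

lemma StAt.up {n : ℕ} (hn : 3 ≤ n) {τ : Equiv.Perm (Fin n)} (hτ : IsPSB τ)
    {k a c : Fin n} (h : StAt τ k a c) (i : Fin n) (hi : i < k) (hki : k ≤ τ i) : i = a :=
  up_unique hn hτ (n - 1 - k) k (by omega) h.1 i a hi hki h.2.1 h.2.2.1

lemma StAt.down {n : ℕ} (hn : 3 ≤ n) {τ : Equiv.Perm (Fin n)} (hτ : IsPSB τ)
    {k a c : Fin n} (h : StAt τ k a c) (i : Fin n) (hi : k ≤ i) (hki : τ i < k) : τ i = c :=
  StAt.up hn (psb_inv hn hτ) h.inv (τ i) hki (by simpa using hi)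

lemma exists_up {n : ℕ} {τ : Equiv.Perm (Fin n)} (h : IsTour τ) (k : Fin n)
    (hk : 0 < (k : ℕ)) : ∃ a < k, k ≤ τ a := by
  by_contra hh
  push Not at hh
  have := tour_closed h (fun j => j < k) ⟨0, by omega⟩ (by rw [Fin.lt_def]; exact hk) hh k
  exact lt_irrefl _ this

lemma exists_state {n : ℕ} {τ : Equiv.Perm (Fin n)} (h : IsTour τ) (k : Fin n)
    (hk : 0 < (k : ℕ)) (hs : ¬ IsStepBackPeak τ k) : ∃ a c, StAt τ k a c := by
  obtain ⟨a, h1, h2⟩ := exists_up h k hk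
  obtain ⟨c, h3, h4⟩ := exists_up (tour_inv h) k hk
  exact ⟨a, c, hs, h1, h2, h3, h4⟩

/-- Tails of two tours in the same state may be exchanged. -/
lemma swap_exists {n : ℕ} (hn : 3 ≤ n) {x y : Equiv.Perm (Fin n)} (hx : IsPSB x) (hy : IsPSB y)
    {k a c : Fin n} (sx : StAt x k a c) (sy : StAt y k a c) :
    ∃ z : Equiv.Perm (Fin n), IsPSB z ∧ (∀ i, i < k → i ≠ a → z i = x i) ∧
      (∀ i, (k ≤ i ∨ i = a) → z i = y i) := by
  classical
  obtain ⟨-, ha, hxa, hc, hxc⟩ := id sx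
  obtain ⟨-, -, hya, -, hyc⟩ := id sy
  have L : ∀ i, i < k → i ≠ a → x i < k := by
    intro i hi hia
    by_contra hh
    exact hia (sx.up hn hx i hi (not_lt.1 hh))
  have hk0 : k ≤ x⁻¹ c := hxc
  let f : Fin n → Fin n := fun i => if i < k ∧ i ≠ a then x i else y i
  have f1 : ∀ i, i < k → i ≠ a → f i = x i := fun i h1 h2 => by simp [f, h1, h2]
  have f2 : ∀ i, (k ≤ i ∨ i = a) → f i = y i := by
    intro i h
    have : ¬ (i < k ∧ i ≠ a) := by
      rintro ⟨h1, h2⟩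
      rcases h with h | h
      · exact absurd h1 (not_lt.2 h)
      · exact h2 h
    simp only [f, this, if_false]
  have cross : ∀ i j, i < k → i ≠ a → (k ≤ j ∨ j = a) → x i ≠ y j := by
    intro i j h1 h2 h3 h4
    have h5 := L i h1 h2
    rcases h3 with h3 | h3
    · have h6 := sy.down hn hy j h3 (by rw [← h4]; exact h5)
      have : x⁻¹ c = i := by rw [← h6, ← h4]; simp
      rw [this] at hxc
      exact absurd h1 (not_lt.2 hxc)
    · rw [h4, h3] at h5
      exact absurd h5 (not_lt.2 hya)
  have dich : ∀ i : Fin n, (i < k ∧ i ≠ a) ∨ (k ≤ i ∨ i = a) := by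
    intro i
    rcases lt_or_ge i k with h | h
    · by_cases h' : i = a
      · exact Or.inr (Or.inr h')
      · exact Or.inl ⟨h, h'⟩
    · exact Or.inr (Or.inl h)
  have inj : Function.Injective f := by
    intro i j hij
    rcases dich i with ⟨h1, h2⟩ | h1 <;> rcases dich j with ⟨h3, h4⟩ | h3
    · rw [f1 i h1 h2, f1 j h3 h4] at hij
      exact x.injective hij
    · rw [f1 i h1 h2, f2 j h3] at hij
      exact (cross i j h1 h2 h3 hij).elim
    · rw [f2 i h1, f1 j h3 h4] at hij
      exact (cross j i h3 h4 h1 hij.symm).elim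
    · rw [f2 i h1, f2 j h3] at hij
      exact y.injective hij
  let z : Equiv.Perm (Fin n) := Equiv.ofBijective f (Finite.injective_iff_bijective.1 inj)
  have z1 : ∀ i, i < k → i ≠ a → z i = x i := f1
  have z2 : ∀ i, (k ≤ i ∨ i = a) → z i = y i := f2
  clear_value z
  have zi : ∀ i j, z i = j → z⁻¹ j = i := by
    rintro i _ rfl; simp
  have w1 : ∀ i, i < k → i ≠ c → z⁻¹ i = x⁻¹ i := by
    intro i h1 h2
    apply zi
    have h3 : x⁻¹ i < k := by
      by_contra h
      exact h2 (StAt.up hn (psb_inv hn hx) sx.inv i h1 (not_lt.1 h))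
    rw [z1 _ h3]
    · simp
    · intro h
      have hxi : x a = i := by rw [← h]; simp
      rw [hxi] at hxa
      exact absurd h1 (not_lt.2 hxa)
  have w2 : ∀ i, k ≤ i ∨ i = c → z⁻¹ i = y⁻¹ i := by
    intro i h1
    apply zi
    rw [z2]
    · simp
    · rcases h1 with h1 | h1
      · rcases le_or_gt k (y⁻¹ i) with h | h
        · exact Or.inl h
        · exact Or.inr (sy.up hn hy _ h (by simpa using h1))
      · left; rw [h1]; exact hyc
  refine ⟨z, ?_, z1, z2⟩
  rw [psb_iff hn]
  constructor
  · apply tour_of_closed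
    intro S i hi hS
    have big : (∃ j, k ≤ j ∧ S j) → S c := by
      rintro ⟨j, hj, hSj⟩
      by_contra hcS
      have := tour_closed hy.1 (fun i => k ≤ i ∧ S i) j ⟨hj, hSj⟩ (by
        rintro i ⟨hi1, hi2⟩
        have h3 : S (y i) := by rw [← z2 i (Or.inl hi1)]; exact hS i hi2
        refine ⟨?_, h3⟩
        by_contra h
        rw [sy.down hn hy i hi1 (not_le.1 h)] at h3
        exact hcS h3) a
      exact absurd ha (not_lt.2 this.1)
    have small : (∃ j, j < k ∧ S j) → S a := by
      rintro ⟨j, hj, hSj⟩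
      by_contra haS
      have := tour_closed hx.1 (fun i => i < k ∧ S i) j ⟨hj, hSj⟩ (by
        rintro i ⟨hi1, hi2⟩
        have h2 : i ≠ a := by rintro rfl; exact haS hi2
        have h3 : S (x i) := by rw [← z1 i hi1 h2]; exact hS i hi2
        exact ⟨L i hi1 h2, h3⟩) k
      exact absurd this.1 (lt_irrefl _)
    have hSc : S c := by
      rcases lt_or_ge i k with h | h
      · have := hS a (small ⟨i, h, hi⟩)
        rw [z2 a (Or.inr rfl)] at this
        exact big ⟨_, hya, this⟩
      · exact big ⟨i, h, hi⟩
    have hSa : S a := small ⟨c, hc, hSc⟩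
    have hSb : S (y a) := by
      rw [← z2 a (Or.inr rfl)]; exact hS a hSa
    have allL := tour_closed hx.1 (fun i => i < k → S i) c (fun _ => hSc) (by
      intro i hi hik
      rcases lt_or_ge i k with h | h
      · by_cases h2 : i = a
        · rw [h2] at hik; exact absurd hik (not_lt.2 hxa)
        · rw [← z1 i h h2]; exact hS i (hi h)
      · rw [sx.down hn hx i h hik]; exact hSc)
    have allR := tour_closed hy.1 (fun i => k ≤ i → S i) (y a) (fun _ => hSb) (by
      intro i hi hik
      rcases lt_or_ge i k with h | h
      · rw [sy.up hn hy i h hik]; exact hSb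
      · rw [← z2 i (Or.inl h)]; exact hS i (hi h))
    intro j
    rcases lt_or_ge j k with h | h
    · exact allL j h
    · exact allR j h
  · intro i hp hin
    obtain ⟨p1, p2⟩ := hp
    rcases lt_or_ge i k with h | h
    · have hic : i ≠ c := by
        rintro rfl
        rw [w2 i (Or.inr rfl)] at p1
        exact absurd (lt_trans p1 h) (not_lt.2 hyc)
      have hia : i ≠ a := by
        rintro rfl
        rw [z2 i (Or.inr rfl)] at p2
        exact absurd (lt_trans p2 h) (not_lt.2 hya)
      have e1 := z1 i h hia
      have e2 := w1 i h hic
      rw [e1] at p2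
      rw [e2] at p1
      have := ((psb_iff hn x).1 hx).2 i ⟨p1, p2⟩ hin
      rcases this with ⟨h1, h2, h3⟩ | ⟨h1, h2, h3⟩
      · left
        rw [e1, e2]
        refine ⟨h1, h2, ?_⟩
        by_cases h4 : x i = a
        · rw [h4, z2 a (Or.inr rfl)]; exact lt_of_lt_of_le h hya
        · rw [z1 _ (lt_trans p2 h) h4]; exact h3
      · right
        rw [e1, e2]
        refine ⟨?_, h2, h3⟩
        by_cases h4 : x⁻¹ i = c
        · rw [h4, w2 c (Or.inr rfl)]; exact lt_of_lt_of_le h hyc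
        · rw [w1 _ (lt_trans p1 h) h4]; exact h1
    · have e1 := z2 i (Or.inl h)
      have e2 := w2 i (Or.inl h)
      rw [e1] at p2
      rw [e2] at p1
      have key := ((psb_iff hn y).1 hy).2 i ⟨p1, p2⟩ hin
      have hik : i ≠ k := by rintro rfl; exact sy.1 key
      have hik' : (k : ℕ) < i := lt_of_le_of_ne h (fun h => hik (Fin.ext h.symm))
      rcases key with ⟨h1, h2, h3⟩ | ⟨h1, h2, h3⟩
      · left
        rw [e1, e2]
        refine ⟨h1, h2, ?_⟩
        rw [z2 _ (Or.inl (by rw [Fin.le_def]; omega))]; exact h3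
      · right
        rw [e1, e2]
        refine ⟨?_, h2, h3⟩
        rw [w2 _ (Or.inl (by rw [Fin.le_def]; omega))]; exact h1

lemma chv_inj {n : ℕ} : Function.Injective (chv (n := n)) := by
  intro x y h
  ext i
  have := congrFun h (i, x i)
  simp only [chv, if_true] at this
  by_cases h2 : y i = x i
  · rw [h2]
  · simp [h2] at this

lemma chv_mem_segment {n : ℕ} {x y z : Equiv.Perm (Fin n)}
    (h : chv z ∈ segment ℝ (chv x) (chv y)) : z = x ∨ z = y := by
  obtain ⟨s, t, hs, ht, hst, h⟩ := h
  by_cases h0 : t = 0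
  · left
    apply chv_inj
    rw [← h, h0]
    have : s = 1 := by linarith
    simp [this]
  by_cases h1 : s = 0
  · right
    apply chv_inj
    rw [← h, h1]
    have : t = 1 := by linarith
    simp [this]
  left
  ext i
  have := congrFun h (i, x i)
  simp only [chv, Pi.add_apply, Pi.smul_apply, smul_eq_mul, if_true] at this
  by_cases h2 : z i = x i
  · rw [h2]
  · rw [if_neg h2] at this
    have hs' : 0 < s := lt_of_le_of_ne hs (Ne.symm h1)
    split_ifs at this <;> linarith

lemma adj_dich {n : ℕ} (hn : 3 ≤ n) {x y : Equiv.Perm (Fin n)} (hx : IsPSB x) (hy : IsPSB y)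
    (hadj : AdjacentIn (PSBvertices n) (chv x) (chv y))
    {k a c : Fin n} (sx : StAt x k a c) (sy : StAt y k a c) :
    (∀ i, i < k → i ≠ a → x i = y i) ∨ (∀ i, (k ≤ i ∨ i = a) → x i = y i) := by
  obtain ⟨z, hz, z1, z2⟩ := swap_exists hn hx hy sx sy
  obtain ⟨t, ht, t1, t2⟩ := swap_exists hn hy hx sy sx
  have hsum : chv x + chv y = chv z + chv t := by
    ext ⟨i, j⟩
    simp only [chv, Pi.add_apply]
    by_cases h : i < k ∧ i ≠ a
    · rw [z1 i h.1 h.2, t1 i h.1 h.2]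
    · have h' : k ≤ i ∨ i = a := by
        by_contra hh
        push Not at hh
        exact h hh
      rw [z2 i h', t2 i h', add_comm]
  have hm : chv z ∈ segment ℝ (chv x) (chv y) := by
    refine hadj.2.2 (subset_convexHull ℝ _ ⟨z, hz, rfl⟩) (subset_convexHull ℝ _ ⟨t, ht, rfl⟩)
      (z := (1/2 : ℝ) • chv x + (1/2 : ℝ) • chv y)
      ⟨1/2, 1/2, by norm_num, by norm_num, by norm_num, rfl⟩
      ⟨1/2, 1/2, by norm_num, by norm_num, by norm_num, ?_⟩
    rw [← smul_add, ← smul_add, hsum]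
  rcases chv_mem_segment hm with rfl | rfl
  · right
    exact z2
  · left
    intro i h1 h2
    exact (z1 i h1 h2).symm

/-- all members of `T` in the same state as `x` at level `k` have the same left part. -/
def LF {n : ℕ} (T : Finset (Equiv.Perm (Fin n))) (x : Equiv.Perm (Fin n)) (k : Fin n) : Prop :=
  ∀ y ∈ T, ∀ a c, StAt x k a c → StAt y k a c → ∀ i, i < k → i ≠ a → y i = x i

/-- all members of `T` in the same state as `x` at level `k` have the same right part. -/
def RF {n : ℕ} (T : Finset (Equiv.Perm (Fin n))) (x : Equiv.Perm (Fin n)) (k : Fin n) : Prop :=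
  ∀ y ∈ T, ∀ a c, StAt x k a c → StAt y k a c → ∀ i, (k ≤ i ∨ i = a) → y i = x i

lemma lf_or_rf {n : ℕ} (hn : 3 ≤ n) (T : Finset (Equiv.Perm (Fin n)))
    (hT : ∀ x ∈ T, IsPSB x)
    (hA : ∀ x ∈ T, ∀ y ∈ T, x ≠ y → AdjacentIn (PSBvertices n) (chv x) (chv y))
    (x : Equiv.Perm (Fin n)) (hx : x ∈ T) (k : Fin n) : LF T x k ∨ RF T x k := by
  have D : ∀ x ∈ T, ∀ y ∈ T, ∀ a c, StAt x k a c → StAt y k a c →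
      (∀ i, i < k → i ≠ a → x i = y i) ∨ (∀ i, (k ≤ i ∨ i = a) → x i = y i) := by
    intro x hx y hy a c sx sy
    by_cases h : x = y
    · subst h; left; intros; rfl
    · exact adj_dich hn (hT x hx) (hT y hy) (hA x hx y hy h) sx sy
  by_cases hL : LF T x k
  · exact Or.inl hL
  right
  unfold LF at hL
  push Not at hL
  obtain ⟨y0, hy0, a0, c0, sx0, sy0, i0, hi0, hia0, hne⟩ := hL
  intro y hy a c sx sy
  have ea : a = a0 := sx0.up hn (hT x hx) a sx.2.1 sx.2.2.1
  have ec : c = c0 := StAt.up hn (psb_inv hn (hT x hx)) sx0.inv c sx.2.2.2.1 sx.2.2.2.2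
  subst ea ec
  have h0 : ∀ i, (k ≤ i ∨ i = a) → y0 i = x i := by
    rcases D y0 hy0 x hx a c sy0 sx with h | h
    · exact absurd (h i0 hi0 hia0) hne
    · exact h
  rcases D y hy x hx a c sy sx with h | h
  · rcases D y hy y0 hy0 a c sy sy0 with h' | h'
    · exact absurd ((h' i0 hi0 hia0).symm.trans (h i0 hi0 hia0)) hne
    · intro i hi
      rw [h' i hi, h0 i hi]
  · exact h

lemma clean_one {n : ℕ} (hn : 3 ≤ n) {x : Equiv.Perm (Fin n)} (hx : IsTour x) (k : Fin n)
    (hk : (k : ℕ) = 1) : ¬ IsStepBackPeak x k := by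
  rintro (⟨h1, h2, h3⟩ | ⟨h1, h2, h3⟩)
  · apply tour_no2 hn (tour_inv hx) k
    have : x⁻¹ k = x k := by ext; rw [Fin.lt_def] at h1; omega
    rw [this]; simp
  · apply tour_no2 hn hx k
    have : x k = x⁻¹ k := by ext; rw [Fin.lt_def] at h3; omega
    rw [this]; simp

lemma exists_pair {n : ℕ} (hn : 3 ≤ n) (T : Finset (Equiv.Perm (Fin n)))
    (hT : ∀ x ∈ T, IsPSB x)
    (hA : ∀ x ∈ T, ∀ y ∈ T, x ≠ y → AdjacentIn (PSBvertices n) (chv x) (chv y))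
    (x : Equiv.Perm (Fin n)) (hx : x ∈ T) :
    ∃ k k' : Fin n, 0 < (k : ℕ) ∧ k ≤ k' ∧ (k' : ℕ) ≤ k + 2 ∧ ¬ IsStepBackPeak x k ∧
      ¬ IsStepBackPeak x k' ∧ LF T x k ∧ RF T x k' := by
  classical
  let Good : Finset (Fin n) := Finset.univ.filter
    (fun k => 0 < (k : ℕ) ∧ ¬ IsStepBackPeak x k ∧ LF T x k)
  have hne : Good.Nonempty := by
    refine ⟨⟨1, by omega⟩, ?_⟩
    simp only [Good, Finset.mem_filter, Finset.mem_univ, true_and]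
    refine ⟨by norm_num, clean_one hn (hT x hx).1 _ rfl, ?_⟩
    intro y hy a c sx sy i hi hia
    exfalso
    have h2 := sx.2.1
    apply hia
    ext
    rw [Fin.lt_def] at hi h2
    simp only at hi h2
    omega
  obtain ⟨k, hk, hmax⟩ := Good.exists_max_image id hne
  simp only [Good, Finset.mem_filter, Finset.mem_univ, true_and, id] at hk hmax
  obtain ⟨k0, kc, kL⟩ := hk
  have later : ∀ k' : Fin n, k < k' → ¬ IsStepBackPeak x k' → RF T x k' := by
    intro k' h1 h2
    rcases lf_or_rf hn T hT hA x hx k' with h | h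
    · have := hmax k' ⟨by rw [Fin.lt_def] at h1; omega, h2, h⟩
      exact absurd h1 (not_lt.2 this)
    · exact h
  by_cases hlast : (k : ℕ) = n - 1
  · refine ⟨k, k, k0, le_rfl, by omega, kc, kc, kL, ?_⟩
    intro y hy a c sx sy i hi
    obtain ⟨-, -, xa, -, xc⟩ := sx
    obtain ⟨-, -, ya, -, yc⟩ := sy
    have tl : ∀ j : Fin n, k ≤ j → j = k := by
      intro j hj
      ext
      have := j.2
      rw [Fin.le_def] at hj
      omega
    rcases hi with hi | hi
    · have h1 := tl _ xc
      have h2 := tl _ yc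
      have h3 := tl _ hi
      have h4 : x k = c := by rw [← h1]; simp
      have h5 : y k = c := by rw [← h2]; simp
      rw [h3, h4, h5]
    · rw [hi, tl _ xa, tl _ ya]
  · have := k.2
    obtain ⟨k1, hk1⟩ : ∃ k1 : Fin n, (k1 : ℕ) = k + 1 := ⟨⟨k + 1, by omega⟩, rfl⟩
    by_cases hs1 : IsStepBackPeak x k1
    · have hl1 : (k1 : ℕ) ≠ n - 1 := fun h => sbp_last x k1 h hs1
      obtain ⟨k2, hk2⟩ : ∃ k2 : Fin n, (k2 : ℕ) = k + 2 := ⟨⟨k + 2, by omega⟩, rfl⟩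
      have hs2 : ¬ IsStepBackPeak x k2 := fun hh => sbp_succ x k1 k2 (by omega) hh hs1
      exact ⟨k, k2, k0, by rw [Fin.le_def]; omega, by omega, kc, hs2, kL,
        later k2 (by rw [Fin.lt_def]; omega) hs2⟩
    · exact ⟨k, k1, k0, by rw [Fin.le_def]; omega, by omega, kc, hs1, kL,
        later k1 (by rw [Fin.lt_def]; omega) hs1⟩

/-- one of the two state components is close to the level. -/
lemma state_near {n : ℕ} (hn : 3 ≤ n) {x : Equiv.Perm (Fin n)} (hx : IsPSB x) {k a c : Fin n}
    (s : StAt x k a c) : (a : ℕ) = k - 1 ∨ (a : ℕ) = k - 2 ∨ (c : ℕ) = k - 1 ∨ (c : ℕ) = k - 2 := by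
  by_contra hh
  push Not at hh
  obtain ⟨h1, h2, h3, h4⟩ := hh
  have hak := s.2.1
  rw [Fin.lt_def] at hak
  obtain ⟨j, hj⟩ : ∃ j : Fin n, (j : ℕ) = k - 1 := ⟨⟨k - 1, by omega⟩, rfl⟩
  have nf := tour_nofix hn hx.1 j
  have nf' := tour_nofix hn (tour_inv hx.1) j
  have hjk : j < k := by rw [Fin.lt_def]; omega
  have u : x j < k := by
    by_contra h
    have := s.up hn hx j hjk (not_lt.1 h)
    rw [this] at hj; omega
  have v : x⁻¹ j < k := by
    by_contra h
    have := StAt.up hn (psb_inv hn hx) s.inv j hjk (not_lt.1 h)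
    rw [this] at hj; omega
  rw [Ne, Fin.ext_iff] at nf nf'
  have pk : IsPeak x j := by
    constructor <;> rw [Fin.lt_def] at * <;> omega
  have sb := ((psb_iff hn x).1 hx).2 j pk (by omega)
  rcases sb with ⟨b1, b2, b3⟩ | ⟨b1, b2, b3⟩
  · have h := s.up hn hx (x j) u (by rw [Fin.le_def]; rw [Fin.lt_def] at b3; omega)
    rw [h] at b2; omega
  · have h := StAt.up hn (psb_inv hn hx) s.inv (x⁻¹ j) v
      (by rw [Fin.le_def]; rw [Fin.lt_def] at b1; omega)
    rw [h] at b2; omega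

/-- the data determining a member of a clique. -/
def Spec {n : ℕ} (T : Finset (Equiv.Perm (Fin n))) (x : Equiv.Perm (Fin n)) (k : Fin n)
    (D : Fin 8 → ℕ) : Prop :=
  ∃ k' a c a' c' : Fin n, (k' : ℕ) = D 0 ∧ (a : ℕ) = D 1 ∧ (c : ℕ) = D 2 ∧ (a' : ℕ) = D 3 ∧
    (c' : ℕ) = D 4 ∧ StAt x k a c ∧ StAt x k' a' c' ∧ (k' : ℕ) ≤ k + 2 ∧ LF T x k ∧ RF T x k' ∧
    ∀ i, x i < k' → (i = a → (x i : ℕ) = D 5) ∧ ((i : ℕ) = k → (x i : ℕ) = D 6) ∧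
      ((i : ℕ) = k + 1 → (x i : ℕ) = D 7)

lemma spec_unique {n : ℕ} (hn : 3 ≤ n) (T : Finset (Equiv.Perm (Fin n)))
    (hT : ∀ x ∈ T, IsPSB x) (x y : Equiv.Perm (Fin n)) (hx : x ∈ T) (hy : y ∈ T) (k : Fin n)
    (D : Fin 8 → ℕ) (sx : Spec T x k D) (sy : Spec T y k D) : x = y := by
  obtain ⟨k', a, c, a', c', e0, e1, e2, e3, e4, s1, s2, hk, L, R, V⟩ := sx
  obtain ⟨k'2, a2, c2, a'2, c'2, f0, f1, f2, f3, f4, t1, t2, -, -, -, W⟩ := sy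
  obtain rfl : k' = k'2 := Fin.ext (by omega)
  obtain rfl : a = a2 := Fin.ext (by omega)
  obtain rfl : c = c2 := Fin.ext (by omega)
  obtain rfl : a' = a'2 := Fin.ext (by omega)
  obtain rfl : c' = c'2 := Fin.ext (by omega)
  refine Equiv.ext fun i => ?_
  by_cases h1 : i < k ∧ i ≠ a
  · exact (L y hy a c s1 t1 i h1.1 h1.2).symm
  by_cases h2 : k' ≤ i ∨ i = a'
  · exact (R y hy a' c' s2 t2 i h2).symm
  push Not at h2
  have hxi : x i < k' := by
    by_contra h
    exact h2.2 (s2.up hn (hT x hx) i h2.1 (not_lt.1 h))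
  have hyi : y i < k' := by
    by_contra h
    exact h2.2 (t2.up hn (hT y hy) i h2.1 (not_lt.1 h))
  have V' := V i hxi
  have W' := W i hyi
  ext
  by_cases hia : i = a
  · rw [V'.1 hia, W'.1 hia]
  · have h3 : k ≤ i := by
      by_contra h
      exact h1 ⟨not_le.1 h, hia⟩
    have h4 := h2.1
    rw [Fin.le_def] at h3
    rw [Fin.lt_def] at h4
    have : (i : ℕ) = k ∨ (i : ℕ) = k + 1 := by omega
    rcases this with h | h
    · rw [V'.2.1 h, W'.2.1 h]
    · rw [V'.2.2 h, W'.2.2 h]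

/-- candidate values -/
def cand (k m : ℕ) : Fin 6 → ℕ := ![m, k, k + 1, k + 2, k - 1, k - 2]

lemma cand_of {k m v : ℕ} (h : v = m ∨ v = k ∨ v = k + 1 ∨ v = k + 2 ∨ v = k - 1 ∨ v = k - 2) :
    ∃ i, v = cand k m i := by
  rcases h with h | h | h | h | h | h
  · exact ⟨0, h⟩
  · exact ⟨1, h⟩
  · exact ⟨2, h⟩
  · exact ⟨3, h⟩
  · exact ⟨4, h⟩
  · exact ⟨5, h⟩

lemma spec_exists {n : ℕ} (hn : 3 ≤ n) (T : Finset (Equiv.Perm (Fin n)))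
    (hT : ∀ x ∈ T, IsPSB x)
    (hA : ∀ x ∈ T, ∀ y ∈ T, x ≠ y → AdjacentIn (PSBvertices n) (chv x) (chv y))
    (x : Equiv.Perm (Fin n)) (hx : x ∈ T) :
    ∃ (k m : Fin n) (f : Fin 8 → Fin 6), Spec T x k (fun j => cand k m (f j)) := by
  obtain ⟨k, k', k0, hkk, hk2, c1, c2, L, R⟩ := exists_pair hn T hT hA x hx
  have hx' := hT x hx
  rw [Fin.le_def] at hkk
  obtain ⟨a, c, s⟩ := exists_state hx'.1 k k0 c1
  obtain ⟨a', c', s'⟩ := exists_state hx'.1 k' (by omega) c2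
  have near := state_near hn hx' s
  obtain ⟨m, ha, hc⟩ : ∃ m : Fin n, ((a : ℕ) = m ∨ (a : ℕ) = k - 1 ∨ (a : ℕ) = k - 2) ∧
      ((c : ℕ) = m ∨ (c : ℕ) = k - 1 ∨ (c : ℕ) = k - 2) := by
    rcases near with h | h | h | h
    · exact ⟨c, by omega, by omega⟩
    · exact ⟨c, by omega, by omega⟩
    · exact ⟨a, by omega, by omega⟩
    · exact ⟨a, by omega, by omega⟩
  have ha' : a' = a ∨ (a' : ℕ) = k ∨ (a' : ℕ) = k + 1 := by
    have h1 := s'.2.1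
    have h2 := s'.2.2.1
    rw [Fin.lt_def] at h1
    rw [Fin.le_def] at h2
    by_cases h : a' < k
    · exact Or.inl (s.up hn hx' a' h (by rw [Fin.le_def]; omega))
    · rw [Fin.lt_def] at h; omega
  have hc' : c' = c ∨ (c' : ℕ) = k ∨ (c' : ℕ) = k + 1 := by
    have h1 := s'.2.2.2.1
    have h2 := s'.2.2.2.2
    rw [Fin.lt_def] at h1
    rw [Fin.le_def] at h2
    by_cases h : c' < k
    · exact Or.inl (StAt.up hn (psb_inv hn hx') s.inv c' h (by rw [Fin.le_def]; omega))
    · rw [Fin.lt_def] at h; omega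
  have val : ∀ i : Fin n, ∃ j, (i = a ∨ k ≤ i) → x i < k' → (x i : ℕ) = cand k m j := by
    intro i
    by_cases h : (i = a ∨ k ≤ i) ∧ x i < k'
    · have : (x i : ℕ) = c ∨ (x i : ℕ) = k ∨ (x i : ℕ) = k + 1 := by
        obtain ⟨h1, h2⟩ := h
        by_cases h3 : x i < k
        · left
          rcases h1 with h1 | h1
          · rw [h1] at h3
            exact absurd h3 (not_lt.2 s.2.2.1)
          · rw [s.down hn hx' i h1 h3]
        · rw [Fin.lt_def] at h2 h3; omega
      obtain ⟨j, hj⟩ := cand_of (k := k) (m := m) (v := x i) (by omega)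
      exact ⟨j, fun _ _ => hj⟩
    · exact ⟨0, fun h1 h2 => absurd ⟨h1, h2⟩ h⟩
  obtain ⟨j0, h0⟩ := cand_of (k := k) (m := m) (v := k') (by omega)
  obtain ⟨j1, h1⟩ := cand_of (k := k) (m := m) (v := a) (by omega)
  obtain ⟨j2, h2⟩ := cand_of (k := k) (m := m) (v := c) (by omega)
  obtain ⟨j3, h3⟩ := cand_of (k := k) (m := m) (v := a') (by rw [Fin.ext_iff] at ha'; omega)
  obtain ⟨j4, h4⟩ := cand_of (k := k) (m := m) (v := c') (by rw [Fin.ext_iff] at hc'; omega)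
  obtain ⟨j5, h5⟩ := val a
  obtain ⟨j6, h6⟩ := val k
  obtain ⟨j7, h7⟩ : ∃ j, ∀ i : Fin n, (i : ℕ) = k + 1 → x i < k' → (x i : ℕ) = cand k m j := by
    by_cases h : (k : ℕ) + 1 < n
    · obtain ⟨j, hj⟩ := val ⟨k + 1, h⟩
      refine ⟨j, fun i hi hx => ?_⟩
      obtain rfl : i = ⟨k + 1, h⟩ := Fin.ext hi
      exact hj (Or.inr (by rw [Fin.le_def]; simp)) hx
    · exact ⟨0, fun i hi => by have := i.2; omega⟩
  refine ⟨k, m, ![j0, j1, j2, j3, j4, j5, j6, j7], k', a, c, a', c', h0, h1, h2, h3, h4, s, s',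
    hk2, L, R, fun i hi => ⟨?_, ?_, ?_⟩⟩
  · rintro rfl
    exact h5 (Or.inl rfl) hi
  · intro hik
    obtain rfl : i = k := Fin.ext hik
    exact h6 (Or.inr le_rfl) hi
  · intro hik
    exact h7 i hik hi

lemma clique_card {n : ℕ} (hn : 3 ≤ n) (T : Finset (Equiv.Perm (Fin n)))
    (hT : ∀ x ∈ T, IsPSB x)
    (hA : ∀ x ∈ T, ∀ y ∈ T, x ≠ y → AdjacentIn (PSBvertices n) (chv x) (chv y)) :
    T.card ≤ 6 ^ 8 * n ^ 2 := by
  classical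
  have H : ∀ x : T, ∃ w : Fin n × Fin n × (Fin 8 → Fin 6),
      Spec T x.1 w.1 (fun j => cand w.1 w.2.1 (w.2.2 j)) := by
    rintro ⟨x, hx⟩
    obtain ⟨k, m, f, h⟩ := spec_exists hn T hT hA x hx
    exact ⟨(k, m, f), h⟩
  choose g hg using H
  have inj : Function.Injective g := by
    intro x y h
    have h1 := hg x
    have h2 := hg y
    rw [← h] at h2
    exact Subtype.ext (spec_unique hn T hT x.1 y.1 x.2 y.2 _ _ h1 h2)
  have := Fintype.card_le_of_injective g inj
  simp only [Fintype.card_coe, Fintype.card_prod, Fintype.card_fin, Fintype.card_fun] at this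
  calc T.card ≤ n * (n * 6 ^ 8) := this
    _ = 6 ^ 8 * n ^ 2 := by ring

lemma clique_bound {n : ℕ} (hn : 3 ≤ n) (V : Finset (Fin n × Fin n → ℝ))
    (hV : (V : Set (Fin n × Fin n → ℝ)) ⊆ PSBvertices n)
    (hA : ∀ u ∈ V, ∀ w ∈ V, u ≠ w → AdjacentIn (PSBvertices n) u w) :
    V.card ≤ 6 ^ 8 * n ^ 2 := by
  classical
  let T : Finset (Equiv.Perm (Fin n)) := Finset.univ.filter (fun τ => IsPSB τ ∧ chv τ ∈ V)
  have hVT : V ⊆ T.image chv := by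
    intro v hv
    obtain ⟨τ, hτ, rfl⟩ := hV hv
    exact Finset.mem_image.2 ⟨τ, by simp [T]; exact ⟨hτ, hv⟩, rfl⟩
  refine ((Finset.card_le_card hVT).trans Finset.card_image_le).trans (clique_card hn T ?_ ?_)
  · intro x hx
    exact (Finset.mem_filter.1 hx).2.1
  · intro x hx y hy hxy
    exact hA _ (Finset.mem_filter.1 hx).2.2 _ (Finset.mem_filter.1 hy).2.2
      (fun h => hxy (chv_inj h))

/-- graph of the tour `0,1,…,P,e,e+1,…,n-1,e-1,e-2,…,P+1`. -/
def GG (n P e i v : ℕ) : Prop :=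
  (i = n - 1 ∧ e = P + 1 ∧ v = 0) ∨ (i = n - 1 ∧ e ≠ P + 1 ∧ v + 1 = e) ∨
  (i < P ∧ v = i + 1) ∨ (e ≤ i ∧ i < n - 1 ∧ v = i + 1) ∨ (i = P ∧ v = e) ∨
  (i = P + 1 ∧ i < e ∧ v = 0) ∨ (P + 1 < i ∧ i < e ∧ v + 1 = i)

/-- successor function of the tour `0,1,…,P,e,e+1,…,n-1,e-1,e-2,…,P+1`. -/
def nx (n P e i : ℕ) : ℕ :=
  if i = n - 1 then (if e = P + 1 then 0 else e - 1)
  else if i < P ∨ e ≤ i then i + 1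
  else if i = P then e
  else if i = P + 1 then 0 else i - 1

lemma nx_GG {n P e i : ℕ} (hP : P < e) (he : e < n) (hi : i < n) : GG n P e i (nx n P e i) := by
  unfold nx GG
  split_ifs <;> omega

lemma GG_fun {n P e i v w : ℕ} (hP : P < e) (he : e < n) (h : GG n P e i v) (h' : GG n P e i w) :
    v = w := by
  unfold GG at *
  omega

lemma GG_inj {n P e i j v : ℕ} (hP : P < e) (he : e < n) (h : GG n P e i v) (h' : GG n P e j v) :
    i = j := by
  unfold GG at *
  omega

lemma GG_lt {n P e i v : ℕ} (hP : P < e) (he : e < n) (h : GG n P e i v) : v < n := by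
  unfold GG at *
  omega

/-- A function on `{0,…,n-1}` which is a Hamiltonian cycle. -/
structure HamF (n : ℕ) (f : ℕ → ℕ) : Prop where
  lt : ∀ i < n, f i < n
  inj : ∀ i < n, ∀ j < n, f i = f j → i = j
  surj : ∀ v < n, ∃ t < n, f t = v
  no2 : ∀ i < n, f (f i) ≠ i
  cl : ∀ S : ℕ → Prop, ∀ i < n, S i → (∀ i < n, S i → S (f i)) → ∀ j < n, S j

lemma HamF.two_down {n h : ℕ} {f : ℕ → ℕ} (H : HamF n f) (hh : h ≤ n) {p q : ℕ} (hp : p < h)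
    (hq : q < h) (hpq : p ≠ q) (fp : h ≤ f p) (fq : h ≤ f q) (s : ℕ) :
    ∃ i, i < n ∧ h ≤ i ∧ f i < h ∧ i ≠ s := by
  by_contra hc
  push Not at hc
  have sub : Finset.range h ⊆ (insert s (((Finset.range h).erase p).erase q)).image f := by
    intro v hv
    have hv := Finset.mem_range.1 hv
    obtain ⟨t, ht, rfl⟩ := H.surj v (by omega)
    refine Finset.mem_image.2 ⟨t, ?_, rfl⟩
    by_cases hth : t < h
    · refine Finset.mem_insert_of_mem (Finset.mem_erase.2 ⟨?_, Finset.mem_erase.2 ⟨?_, ?_⟩⟩)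
      · rintro rfl; omega
      · rintro rfl; omega
      · simpa using hth
    · rw [hc t ht (by omega) hv]
      exact Finset.mem_insert_self _ _
  have c1 := (Finset.card_le_card sub).trans Finset.card_image_le
  have c2 := Finset.card_insert_le s (((Finset.range h).erase p).erase q)
  rw [Finset.card_erase_of_mem (Finset.mem_erase.2 ⟨hpq.symm, by simpa using hq⟩),
    Finset.card_erase_of_mem (by simpa using hp), Finset.card_range] at c2
  rw [Finset.card_range] at c1
  omega

lemma GG_mk {n P e i w : ℕ} (hP : P < e) (he : e < n) (hi : i < n)
    (h : ∀ v, GG n P e i v → w = v) : GG n P e i w := by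
  have g := nx_GG hP he hi
  rw [h _ g]
  exact g

lemma GG_sw {n P e i w : ℕ} {Q : Prop} (hP : P < e) (he : e < n) (hi : i < n)
    (u : GG n P e i w ∨ Q) (h : ∀ v, GG n P e i v → Q → w = v) : GG n P e i w := by
  rcases u with u | u
  · exact u
  · exact GG_mk hP he hi (fun v g => h v g u)

lemma dc_aux {n h P e P' e' : ℕ} {f : ℕ → ℕ} (H : HamF n f) (hP : P < h) (he : e = h)
    (hen : e < n) (hP' : P' < h) (he' : h < e') (hen' : e' < n)
    (U : ∀ i < n, GG n P e i (f i) ∨ GG n P' e' i (f i)) (hne : P ≠ P') (h1 : f P = e)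
    (h2 : f P' = e') : False := by
  obtain ⟨i, i1, i2, i3, i4⟩ := H.two_down (by omega) hP hP' hne (by omega) (by omega) h
  obtain ⟨j, j1, j2, j3, j4⟩ := H.two_down (by omega) hP hP' hne (by omega) (by omega) (n - 1)
  have hi : i = n - 1 := by
    have := U i i1
    unfold GG at this; omega
  have hj : j = h := by
    have := U j j1
    unfold GG at this; omega
  subst hi hj
  have a1 := U _ i1
  have a2 := U _ j1
  have a3 := H.inj _ i1 _ j1
  have a4 := H.no2 j j1
  have a5 := H.no2 P (by omega)
  unfold GG at a1 a2
  by_cases hPj : P + 1 = j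
  · have : f j = P := by omega
    rw [h1, he, this] at a5
    exact a5 rfl
  · have hP'j : P' + 1 = j := by omega
    have hf : f j = 0 := by omega
    have := H.cl (fun i => i ≤ P ∨ i = j) j j1 (Or.inr rfl) (by
      intro i hi hS
      rcases hS with hS | hS
      · have := U i hi
        by_cases hiP : i = P
        · right; rw [hiP, h1, he]
        · unfold GG at this; left; omega
      · left; rw [hS, hf]; omega) (n - 1) (by omega)
    omega

lemma dc {n h P e P' e' : ℕ} {f : ℕ → ℕ} (H : HamF n f) (hP : P < h) (he : h ≤ e)
    (hen : e < n) (hP' : P' < h) (he' : h ≤ e') (hen' : e' < n)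
    (U : ∀ i < n, GG n P e i (f i) ∨ GG n P' e' i (f i)) (hne : P ≠ P') (h1 : f P = e)
    (h2 : f P' = e') : False := by
  by_cases c1 : e = h
  · by_cases c2 : e' = h
    · exact hne (H.inj P (by omega) P' (by omega) (by omega))
    · exact dc_aux H hP c1 hen hP' (by omega) hen' U hne h1 h2
  · by_cases c2 : e' = h
    · exact dc_aux H hP' c2 hen' hP (by omega) hen (fun i hi => (U i hi).symm) hne.symm h2 h1
    · obtain ⟨i, i1, i2, i3, i4⟩ := H.two_down (by omega) hP hP' hne (by omega) (by omega) h
      have := U i i1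
      unfold GG at this
      omega

set_option maxHeartbeats 4000000 in
lemma core_left {n h P e P' e' : ℕ} {f : ℕ → ℕ} (H : HamF n f) (hP : P < h) (he : h ≤ e)
    (hen : e < n) (hP' : P' < h) (he' : h ≤ e') (hen' : e' < n)
    (U : ∀ i < n, GG n P e i (f i) ∨ GG n P' e' i (f i)) (h1 : f P = e) :
    ∀ i < h, GG n P e i (f i) := by
  have gP : GG n P e P (f P) := by exact GG_mk (by omega) hen (by omega) (fun v g => by unfold GG at g; omega)
  rcases lt_trichotomy P P' with hlt | heq | hgt
  · have h2 : f P' ≠ e' := fun h2 => dc H hP he hen hP' he' hen' U (by omega) h1 h2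
    have base : GG n P e P' (f P') := by
      have u := U P' (by omega)
      exact GG_sw (by omega) hen (by omega) u (fun v g g' => by unfold GG at g g'; omega)
    have down : ∀ d, P + d < P' → GG n P e (P' - d) (f (P' - d)) := by
      intro d
      induction d with
      | zero => intro _; simpa using base
      | succ d ih =>
        intro hd
        have ih := ih (by omega)
        obtain ⟨j, hj⟩ : ∃ j, j = P' - (d + 1) := ⟨_, rfl⟩
        have e1 : P' - d = j + 1 := by omega
        rw [e1] at ih
        rw [← hj]
        have e2 : f (j + 1) = j := by unfold GG at ih; omega
        have u := U j (by omega)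
        have nn := H.no2 j (by omega)
        have : f j ≠ j + 1 := by
          intro h; rw [h] at nn; exact nn e2
        exact GG_sw (by omega) hen (by omega) u (fun v g g' => by unfold GG at g g'; omega)
    have f0 : f (P + 1) = 0 := by
      have := down (P' - (P + 1)) (by omega)
      rw [show P' - (P' - (P + 1)) = P + 1 by omega] at this
      unfold GG at this; omega
    intro i hi
    have u := U i (by omega)
    by_cases c1 : P < i ∧ i ≤ P'
    · have := down (P' - i) (by omega)
      rwa [show P' - (P' - i) = i by omega] at this
    · by_cases c2 : i = P' + 1
      · have : f i ≠ 0 := by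
          intro h
          have := H.inj i (by omega) (P + 1) (by omega) (by omega)
          omega
        exact GG_sw (by omega) hen (by omega) u (fun v g g' => by unfold GG at g g'; omega)
      · by_cases c3 : i = P
        · rw [c3]; exact gP
        · exact GG_sw (by omega) hen (by omega) u (fun v g g' => by unfold GG at g g'; omega)
  · intro i hi
    have u := U i (by omega)
    by_cases c3 : i = P
    · rw [c3]; exact gP
    · exact GG_sw (by omega) hen (by omega) u (fun v g g' => by unfold GG at g g'; omega)
  · have h2 : f P' ≠ e' := fun h2 => dc H hP he hen hP' he' hen' U (by omega) h1 h2
    have base : GG n P e P' (f P') := by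
      have u := U P' (by omega)
      exact GG_sw (by omega) hen (by omega) u (fun v g g' => by unfold GG at g g'; omega)
    have up : ∀ d, P' + d < P → f (P' + d) = P' + d + 1 := by
      intro d
      induction d with
      | zero => intro _; unfold GG at base; simp only [add_zero]; omega
      | succ d ih =>
        intro hd
        have ih := ih (by omega)
        have u := U (P' + (d + 1)) (by omega)
        have nn := H.no2 (P' + d) (by omega)
        rw [ih] at nn
        have n0 : d = 0 → f (P' + (d + 1)) ≠ 0 := by
          intro d0 hf0
          subst d0
          have := H.cl (fun i => i ≤ P' + 1) 0 (by omega) (by simp) (by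
            intro i hi hS
            have u := U i hi
            by_cases c1 : i = P'
            · subst c1; simp only [add_zero] at ih; omega
            · by_cases c2 : i = P' + 1
              · subst c2; simp only [zero_add] at hf0; omega
              · unfold GG at u; omega) (n - 1) (by omega)
          omega
        rw [show P' + d + 1 = P' + (d + 1) by omega] at nn
        unfold GG at u; omega
    intro i hi
    have u := U i (by omega)
    by_cases c1 : P' ≤ i ∧ i < P
    · have := up (i - P') (by omega)
      rw [show P' + (i - P') = i by omega] at this
      exact GG_mk (by omega) hen (by omega) (fun v g => by unfold GG at g; omega)
    · by_cases c2 : i = P + 1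
      · have : f i ≠ P := by
          intro h
          have h3 := up (P - 1 - P') (by omega)
          rw [show P' + (P - 1 - P') = P - 1 by omega] at h3
          have := H.inj i (by omega) (P - 1) (by omega) (by omega)
          omega
        exact GG_sw (by omega) hen (by omega) u (fun v g g' => by unfold GG at g g'; omega)
      · by_cases c3 : i = P
        · rw [c3]; exact gP
        · exact GG_sw (by omega) hen (by omega) u (fun v g g' => by unfold GG at g g'; omega)

lemma one_point {n P e : ℕ} {f : ℕ → ℕ} (H : HamF n f) (hP : P < e) (hen : e < n) (s : ℕ)
    (h : ∀ i < n, i ≠ s → GG n P e i (f i)) : ∀ i < n, GG n P e i (f i) := by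
  intro i hi
  by_cases hs : i = s
  · subst hs
    have g := nx_GG hP hen hi
    obtain ⟨t, ht, hft⟩ := H.surj _ (GG_lt hP hen g)
    by_cases hti : t = i
    · rw [← hti, hft, hti]; exact g
    · have := h t ht hti
      rw [hft] at this
      exact absurd (GG_inj hP hen this g) hti
  · exact h i hi hs

set_option maxHeartbeats 4000000 in
lemma core {n h P e P' e' : ℕ} {f : ℕ → ℕ} (H : HamF n f) (hP : P < h) (he : h ≤ e)
    (hen : e < n) (hP' : P' < h) (he' : h ≤ e') (hen' : e' < n)
    (U : ∀ i < n, GG n P e i (f i) ∨ GG n P' e' i (f i)) (h1 : f P = e) :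
    ∀ i < n, GG n P e i (f i) := by
  have L := core_left H hP he hen hP' he' hen' U h1
  rcases lt_trichotomy e e' with hlt | heq | hgt
  · have fe : f e = e + 1 := by
      by_contra hfe
      have := H.cl (fun i => i ≤ e) 0 (by omega) (by simp) (by
        intro i hi hS
        have u := U i hi
        by_cases c : i < h
        · have := L i c
          unfold GG at this; omega
        · by_cases c2 : i = e
          · subst c2; unfold GG at u; omega
          · unfold GG at u; omega) (n - 1) (by omega)
      omega
    have up : ∀ d, e + d < e' → f (e + d) = e + d + 1 := by
      intro d
      induction d with
      | zero => intro _; simpa using fe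
      | succ d ih =>
        intro hd
        have ih := ih (by omega)
        have u := U (e + (d + 1)) (by omega)
        have nn := H.no2 (e + d) (by omega)
        rw [ih, show e + d + 1 = e + (d + 1) by omega] at nn
        unfold GG at u; omega
    have hl : f (n - 1) + 1 ≠ e' := by
      intro hl
      by_cases c : e' = e + 1
      · have := H.inj P (by omega) (n - 1) (by omega) (by omega)
        omega
      · have h3 := up (e' - 2 - e) (by omega)
        rw [show e + (e' - 2 - e) = e' - 2 by omega] at h3
        have := H.inj (n - 1) (by omega) (e' - 2) (by omega) (by omega)
        omega
    apply one_point H (by omega) hen (if e = h then n - 1 else h)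
    intro i hi his
    by_cases c : i < h
    · exact L i c
    by_cases c1 : e ≤ i ∧ i < e'
    · have := up (i - e) (by omega)
      rw [show e + (i - e) = i by omega] at this
      exact GG_mk (by omega) hen (by omega) (fun v g => by unfold GG at g; omega)
    have u := U i hi
    by_cases c2 : i = n - 1
    · subst c2
      split_ifs at his with c3
      · exact absurd rfl his
      · exact GG_sw (by omega) hen (by omega) u (fun v g g' => by unfold GG at g g'; omega)
    · split_ifs at his with c3
      · exact GG_sw (by omega) hen (by omega) u (fun v g g' => by unfold GG at g g'; omega)
      · exact GG_sw (by omega) hen (by omega) u (fun v g g' => by unfold GG at g g'; omega)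
  · apply one_point H (by omega) hen (if e = h then n - 1 else h)
    intro i hi his
    by_cases c : i < h
    · exact L i c
    have u := U i hi
    split_ifs at his with c3
    · exact GG_sw (by omega) hen (by omega) u (fun v g g' => by unfold GG at g g'; omega)
    · exact GG_sw (by omega) hen (by omega) u (fun v g g' => by unfold GG at g g'; omega)
  · have down : ∀ d, e' + d < e → GG n P e (e - 1 - d) (f (e - 1 - d)) := by
      intro d
      induction d with
      | zero =>
        intro _
        have u := U (e - 1) (by omega)
        have : f (e - 1) ≠ e := by
          intro h
          have := H.inj P (by omega) (e - 1) (by omega) (by omega)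
          omega
        simp only [Nat.sub_zero]
        exact GG_sw (by omega) hen (by omega) u (fun v g g' => by unfold GG at g g'; omega)
      | succ d ih =>
        intro hd
        have ih := ih (by omega)
        obtain ⟨j, hj⟩ : ∃ j, j = e - 1 - (d + 1) := ⟨_, rfl⟩
        have e1 : e - 1 - d = j + 1 := by omega
        rw [e1] at ih
        rw [← hj]
        have e2 : f (j + 1) = j := by unfold GG at ih; omega
        have u := U j (by omega)
        have nn := H.no2 j (by omega)
        have : f j ≠ j + 1 := by
          intro h; rw [h] at nn; exact nn e2
        exact GG_sw (by omega) hen (by omega) u (fun v g g' => by unfold GG at g g'; omega)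
    have gz := down (e - 1 - e') (by omega)
    rw [show e - 1 - (e - 1 - e') = e' by omega] at gz
    have hl : h < e' → f (n - 1) + 1 ≠ e' := by
      intro hh hl
      have : f e' = e' - 1 := by unfold GG at gz; omega
      have := H.inj (n - 1) (by omega) e' (by omega) (by omega)
      omega
    apply one_point H (by omega) hen (if e' = h then n - 1 else h)
    intro i hi his
    by_cases c : i < h
    · exact L i c
    by_cases c1 : e' ≤ i ∧ i < e
    · have := down (e - 1 - i) (by omega)
      rwa [show e - 1 - (e - 1 - i) = i by omega] at this
    have u := U i hi
    by_cases c2 : i = n - 1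
    · subst c2
      split_ifs at his with c3
      · exact absurd rfl his
      · exact GG_sw (by omega) hen (by omega) u (fun v g g' => by unfold GG at g g'; omega)
    · split_ifs at his with c3
      · exact GG_sw (by omega) hen (by omega) u (fun v g g' => by unfold GG at g g'; omega)
      · exact GG_sw (by omega) hen (by omega) u (fun v g g' => by unfold GG at g g'; omega)

lemma core_or {n h P e P' e' : ℕ} {f : ℕ → ℕ} (H : HamF n f) (hP : P < h) (he : h ≤ e)
    (hen : e < n) (hP' : P' < h) (he' : h ≤ e') (hen' : e' < n)
    (U : ∀ i < n, GG n P e i (f i) ∨ GG n P' e' i (f i)) :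
    (∀ i < n, GG n P e i (f i)) ∨ (∀ i < n, GG n P' e' i (f i)) := by
  by_cases h1 : f P = e
  · exact Or.inl (core H hP he hen hP' he' hen' U h1)
  by_cases h2 : f P' = e'
  · exact Or.inr (core H hP' he' hen' hP he hen (fun i hi => (U i hi).symm) h2)
  exfalso
  have := H.cl (fun i => i < h) 0 (by omega) (by omega) (by
    intro i hi hS
    have u := U i hi
    by_cases c1 : i = P
    · by_cases c2 : P = P'
      · rw [← c2] at h2; subst c1; unfold GG at u; omega
      · subst c1; unfold GG at u; omega
    by_cases c2 : i = P'
    · subst c2; unfold GG at u; omega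
    unfold GG at u; omega) (n - 1) (by omega)
  omega

/-- the tour as a permutation -/
noncomputable def tr (n P e : ℕ) (hP : P < e) (he : e < n) : Equiv.Perm (Fin n) :=
  Equiv.ofBijective (fun i : Fin n => (⟨nx n P e i, GG_lt hP he (nx_GG hP he i.2)⟩ : Fin n))
    (Finite.injective_iff_bijective.1 (by
      intro i j hij
      have h : nx n P e i = nx n P e j := congrArg Fin.val hij
      have h1 := nx_GG hP he i.2
      have h2 := nx_GG hP he j.2
      rw [h] at h1
      exact Fin.ext (GG_inj hP he h1 h2)))

lemma tr_GG {n P e : ℕ} (hP : P < e) (he : e < n) (i : Fin n) :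
    GG n P e i (tr n P e hP he i) := nx_GG hP he i.2

lemma tr_tour {n P e : ℕ} (hP : P < e) (he : e < n) : IsTour (tr n P e hP he) := by
  rw [tour_iff_sameCycle]
  set x := tr n P e hP he with hx
  let o : Fin n := ⟨0, by omega⟩
  have step : ∀ (i j : ℕ) (hi : i < n) (hj : j < n), GG n P e i j →
      (x.SameCycle o ⟨i, hi⟩ ↔ x.SameCycle o ⟨j, hj⟩) := by
    intro i j hi hj g
    have : x ⟨i, hi⟩ = ⟨j, hj⟩ := Fin.ext (GG_fun hP he (tr_GG hP he ⟨i, hi⟩) g)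
    rw [← this, Equiv.Perm.sameCycle_apply_right]
  have A : ∀ i (hi : i < n), i ≤ P → x.SameCycle o ⟨i, hi⟩ := by
    intro i
    induction i with
    | zero => intro _ _; exact Equiv.Perm.SameCycle.refl _ _
    | succ i ih =>
      intro hi hiP
      exact (step i (i + 1) (by omega) hi (by unfold GG; omega)).1 (ih (by omega) (by omega))
  have B : ∀ d (hi : e + d < n), x.SameCycle o ⟨e + d, hi⟩ := by
    intro d
    induction d with
    | zero => intro hi; exact (step P e (by omega) he (by unfold GG; omega)).1 (A P (by omega) le_rfl)
    | succ d ih =>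
      intro hi
      exact (step (e + d) (e + (d + 1)) (by omega) hi (by unfold GG; omega)).1 (ih (by omega))
  have C : ∀ d (hi : P + 1 + d < n), P + 1 + d < e → x.SameCycle o ⟨P + 1 + d, hi⟩ := by
    intro d
    induction d with
    | zero =>
      intro hi hlt
      exact (step (P + 1) 0 hi (by omega) (by unfold GG; omega)).2 (Equiv.Perm.SameCycle.refl _ _)
    | succ d ih =>
      intro hi hlt
      exact (step (P + 1 + (d + 1)) (P + 1 + d) hi (by omega) (by unfold GG; omega)).2
        (ih (by omega) (by omega))
  have all : ∀ i, x.SameCycle o i := by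
    rintro ⟨i, hi⟩
    by_cases h1 : i ≤ P
    · exact A i hi h1
    by_cases h2 : e ≤ i
    · have := B (i - e) (by omega)
      simpa [show e + (i - e) = i by omega] using this
    · have := C (i - (P + 1)) (by omega) (by omega)
      simpa [show P + 1 + (i - (P + 1)) = i by omega] using this
  intro i j
  exact (all i).symm.trans (all j)

lemma tr_psb {n P e : ℕ} (hn : 3 ≤ n) (hP : P < e) (he : e < n) : IsPSB (tr n P e hP he) := by
  rw [psb_iff hn]
  refine ⟨tr_tour hP he, fun i hp hi => ?_⟩
  exfalso
  obtain ⟨h1, h2⟩ := hp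
  have g1 := tr_GG hP he i
  have g2 := tr_GG hP he ((tr n P e hP he)⁻¹ i)
  rw [show tr n P e hP he ((tr n P e hP he)⁻¹ i) = i by simp] at g2
  rw [Fin.lt_def] at h1 h2
  unfold GG at g1 g2
  omega

lemma hamF_of_tour {n : ℕ} (hn : 3 ≤ n) {z : Equiv.Perm (Fin n)} (hz : IsTour z) :
    HamF n (fun i => if h : i < n then (z ⟨i, h⟩ : ℕ) else 0) where
  lt := by
    intro i hi
    simp [hi]
  inj := by
    intro i hi j hj h
    simp only [hi, hj, dite_true] at h
    exact congrArg Fin.val (z.injective (Fin.ext h))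
  surj := by
    intro v hv
    refine ⟨z⁻¹ ⟨v, hv⟩, Fin.is_lt _, ?_⟩
    simp
  no2 := by
    intro i hi
    simp only [hi, dite_true, Fin.is_lt, Fin.eta]
    intro h
    exact tour_no2 hn hz ⟨i, hi⟩ (Fin.ext h)
  cl := by
    intro S i hi hSi hS j hj
    refine tour_closed hz (fun i => S i) ⟨i, hi⟩ hSi ?_ ⟨j, hj⟩
    intro i hSi
    have := hS i i.2 hSi
    simpa using this

lemma union_tour {n h P e P' e' : ℕ} (hn : 3 ≤ n) (hP : P < h) (he : h ≤ e)
    (hen : e < n) (hP' : P' < h) (he' : h ≤ e') (hen' : e' < n)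
    (z : Equiv.Perm (Fin n)) (hz : IsTour z)
    (U : ∀ i, z i = tr n P e (by omega) hen i ∨ z i = tr n P' e' (by omega) hen' i) :
    z = tr n P e (by omega) hen ∨ z = tr n P' e' (by omega) hen' := by
  have := core_or (hamF_of_tour hn hz) hP he hen hP' he' hen' (by
    intro i hi
    simp only [hi, dite_true]
    rcases U ⟨i, hi⟩ with h | h
    · left; rw [h]; exact tr_GG (by omega) hen ⟨i, hi⟩
    · right; rw [h]; exact tr_GG (by omega) hen' ⟨i, hi⟩)
  rcases this with h | h
  · left
    ext i
    have h1 := h i i.2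
    simp only [Fin.is_lt, dite_true, Fin.eta] at h1
    exact GG_fun (by omega) hen h1 (tr_GG (by omega) hen i)
  · right
    ext i
    have h1 := h i i.2
    simp only [Fin.is_lt, dite_true, Fin.eta] at h1
    exact GG_fun (by omega) hen' h1 (tr_GG (by omega) hen' i)

/-- points of a convex hull on a supporting hyperplane. -/
lemma hull_face {E : Type*} [AddCommGroup E] [Module ℝ E] (S : Set E) (l : E →ₗ[ℝ] ℝ)
    (hl : ∀ s ∈ S, 0 ≤ l s) (u : E) (hu : u ∈ convexHull ℝ S) :
    0 ≤ l u ∧ (l u = 0 → u ∈ convexHull ℝ {s ∈ S | l s = 0}) := by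
  have hc : Convex ℝ {u : E | 0 ≤ l u ∧ (l u = 0 → u ∈ convexHull ℝ {s ∈ S | l s = 0})} := by
    rintro u ⟨hu1, hu2⟩ v ⟨hv1, hv2⟩ a b ha hb hab
    have e : l (a • u + b • v) = a * l u + b * l v := by simp
    have m1 := mul_nonneg ha hu1
    have m2 := mul_nonneg hb hv1
    refine ⟨by rw [e]; positivity, fun h0 => ?_⟩
    rw [e] at h0
    have z1 : a * l u = 0 := by linarith
    have z2 : b * l v = 0 := by linarith
    rcases mul_eq_zero.1 z1 with h | h
    · have hb1 : b = 1 := by linarith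
      rw [h, hb1, zero_smul, one_smul, zero_add]
      rw [hb1, one_mul] at z2
      exact hv2 z2
    · rcases mul_eq_zero.1 z2 with h' | h'
      · have ha1 : a = 1 := by linarith
        rw [h', ha1, zero_smul, one_smul, add_zero]
        exact hu2 h
      · exact convex_convexHull ℝ _ (hu2 h) (hv2 h') ha hb hab
  have hsub : S ⊆ {u : E | 0 ≤ l u ∧ (l u = 0 → u ∈ convexHull ℝ {s ∈ S | l s = 0})} :=
    fun s hs => ⟨hl s hs, fun h0 => subset_convexHull ℝ _ ⟨hs, h0⟩⟩
  exact convexHull_min hsub hc hu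

lemma adj_of_union {n : ℕ} (x y : Equiv.Perm (Fin n)) (hx : IsPSB x) (hy : IsPSB y) (hxy : x ≠ y)
    (U : ∀ z : Equiv.Perm (Fin n), IsPSB z → (∀ i, z i = x i ∨ z i = y i) → z = x ∨ z = y) :
    AdjacentIn (PSBvertices n) (chv x) (chv y) := by
  classical
  refine ⟨fun h => hxy (chv_inj h), ?_⟩
  let Out : Finset (Fin n × Fin n) := Finset.univ.filter (fun e => x e.1 ≠ e.2 ∧ y e.1 ≠ e.2)
  let l : (Fin n × Fin n → ℝ) →ₗ[ℝ] ℝ := ∑ e ∈ Out, LinearMap.proj e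
  have lapp : ∀ v, l v = ∑ e ∈ Out, v e := by intro v; simp [l]
  have hxm : chv x ∈ PSBvertices n := ⟨x, hx, rfl⟩
  have hym : chv y ∈ PSBvertices n := ⟨y, hy, rfl⟩
  have lx : l (chv x) = 0 := by
    rw [lapp]
    refine Finset.sum_eq_zero fun e he => ?_
    have := (Finset.mem_filter.1 he).2.1
    simp [chv, this]
  have ly : l (chv y) = 0 := by
    rw [lapp]
    refine Finset.sum_eq_zero fun e he => ?_
    have := (Finset.mem_filter.1 he).2.2
    simp [chv, this]
  have chv_nn : ∀ (z : Equiv.Perm (Fin n)) e, 0 ≤ chv z e := by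
    intro z e
    simp only [chv]
    split_ifs <;> norm_num
  have nn : ∀ s ∈ PSBvertices n, 0 ≤ l s := by
    rintro _ ⟨z, -, rfl⟩
    rw [lapp]
    exact Finset.sum_nonneg fun e _ => chv_nn z e
  have sub : {s ∈ PSBvertices n | l s = 0} ⊆ {chv x, chv y} := by
    rintro _ ⟨⟨z, hz, rfl⟩, h0⟩
    rw [lapp, Finset.sum_eq_zero_iff_of_nonneg (fun e _ => chv_nn z e)] at h0
    have := U z hz (by
      intro i
      by_contra hh
      push Not at hh
      have := h0 (i, z i) (by simp [Out]; exact ⟨hh.1.symm, hh.2.symm⟩)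
      simp [chv] at this)
    rcases this with rfl | rfl <;> simp
  constructor
  · exact (convex_convexHull ℝ _).segment_subset (subset_convexHull ℝ _ hxm)
      (subset_convexHull ℝ _ hym)
  · intro u hu v hv w hw hwo
    have hu' := hull_face _ l nn u hu
    have hv' := hull_face _ l nn v hv
    have lw : l w = 0 := by
      obtain ⟨a, b, -, -, -, rfl⟩ := hw
      simp [lx, ly]
    obtain ⟨a, b, ha, hb, hab, rfl⟩ := hwo
    have e : l (a • u + b • v) = a * l u + b * l v := by simp
    rw [e] at lw
    have m1 := mul_nonneg ha.le hu'.1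
    have m2 := mul_nonneg hb.le hv'.1
    have z1 : a * l u = 0 := by linarith
    have z2 : l u = 0 := by
      rcases mul_eq_zero.1 z1 with h | h
      · exact absurd h ha.ne'
      · exact h
    have := convexHull_mono sub (hu'.2 z2)
    rwa [convexHull_pair] at this

lemma clique_lower {n : ℕ} (hn : 3 ≤ n) : ∃ V : Finset (Fin n × Fin n → ℝ),
    ↑V ⊆ PSBvertices n ∧ (∀ u ∈ V, ∀ w ∈ V, u ≠ w → AdjacentIn (PSBvertices n) u w) ∧
    (n / 2) ^ 2 ≤ V.card := by
  classical
  let h := n / 2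
  have hh : h = n / 2 := rfl
  have bd : ∀ p : Fin h × Fin (n - h), (p.1 : ℕ) < h + p.2 ∧ h + (p.2 : ℕ) < n := by
    intro p
    have := p.1.2
    have := p.2.2
    omega
  let g : Fin h × Fin (n - h) → Equiv.Perm (Fin n) :=
    fun p => tr n p.1 (h + p.2) (bd p).1 (bd p).2
  have ginj : Function.Injective g := by
    intro p q hpq
    have b1 := bd p
    have b2 := bd q
    have := p.1.2
    have := q.1.2
    have g1 := tr_GG (bd p).1 (bd p).2 ⟨p.1, by omega⟩
    have g2 := tr_GG (bd q).1 (bd q).2 ⟨p.1, by omega⟩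
    change GG _ _ _ _ ((g p) _ : Fin n).1 at g1
    change GG _ _ _ _ ((g q) _ : Fin n).1 at g2
    rw [hpq] at g1
    simp only at g1 g2
    unfold GG at g1 g2
    ext <;> omega
  refine ⟨Finset.univ.image (fun p => chv (g p)), ?_, ?_, ?_⟩
  · intro v hv
    obtain ⟨p, -, rfl⟩ := Finset.mem_image.1 (Finset.mem_coe.1 hv)
    exact ⟨g p, tr_psb hn _ _, rfl⟩
  · intro u hu w hw huw
    obtain ⟨p, -, rfl⟩ := Finset.mem_image.1 hu
    obtain ⟨q, -, rfl⟩ := Finset.mem_image.1 hw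
    apply adj_of_union _ _ (tr_psb hn _ _) (tr_psb hn _ _)
    · intro heq
      exact huw (congrArg chv heq)
    · intro z hz hU
      exact union_tour hn p.1.2 (by omega) (bd p).2 q.1.2 (by omega) (bd q).2 z hz.1 hU
  · have hinj : Function.Injective (fun p => chv (g p)) := chv_inj.comp ginj
    rw [Finset.card_image_of_injective _ hinj]
    simp only [Finset.card_univ, Fintype.card_prod, Fintype.card_fin]
    rw [pow_two]
    exact Nat.mul_le_mul le_rfl (by omega)

/-- The clique number of the 1-skeleton of `PSB(n)` is `O(n²)`, and together with the
lower bound `⌊n/2⌋²` it is `Θ(n²)`. -/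
theorem stmt5 : ∃ C : ℕ, 0 < C ∧ ∀ n : ℕ, 3 ≤ n →
    PSBCliqueNumber n ≤ C * n ^ 2 ∧ (n / 2) ^ 2 ≤ PSBCliqueNumber n := by
  refine ⟨6 ^ 8, by norm_num, fun n hn => ?_⟩
  constructor
  · refine csSup_le ⟨0, ∅, by simp, by simp, rfl⟩ ?_
    rintro m ⟨V, hV, hA, rfl⟩
    exact clique_bound hn V hV hA
  · obtain ⟨V, hV, hA, hc⟩ := clique_lower hn
    refine hc.trans (le_csSup ⟨6 ^ 8 * n ^ 2, ?_⟩ ⟨V, hV, hA, rfl⟩)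
    rintro m ⟨W, hW, hB, rfl⟩
    exact clique_bound hn W hW hB
end
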